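/- arXiv:math/0703684 — 5 statements merged into one kernel-verified Lean document; each statement's English description precedes it below -/
import Mathlib

section
/- Let M be a real n×n matrix and n_+, n_− ∈ ℕ with n_+ + n_− = n. The following are equivalent: (A) counted with algebraic multiplicity, M has exactly n_+ complex eigenvalues with positive real part and exactly n_− with negative real part; (B) there exist a real symmetric n×n matrix G having exactly n_+ positive and n_− negative eigenvalues, and a constant C > 0, such that ⟨G M x, x⟩ + ⟨G x, M x⟩ ≥ |x|²/C for all x ∈ ℝ^n (i.e. the derivative of the quadratic form x ↦ ⟨Gx, x⟩ along the linear vector field Mx·∂_x is bounded below by |x|²/C). -/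
open Matrix
open scoped Classical

noncomputable section

/-- The number of eigenvalues (roots of the characteristic polynomial over `ℂ`, with
algebraic multiplicity) of a complex matrix satisfying the predicate `pred`. -/
def eigCount {n : ℕ} (M : Matrix (Fin n) (Fin n) ℂ) (pred : ℂ → Prop) : ℕ :=
  Multiset.card (Multiset.filter pred (Matrix.charpoly M).roots)

/-- The number of real eigenvalues (with multiplicity) of a real matrix satisfying
`pred`. -/
def eigCountR {n : ℕ} (G : Matrix (Fin n) (Fin n) ℝ) (pred : ℝ → Prop) : ℕ :=
  Multiset.card (Multiset.filter pred (Matrix.charpoly G).roots)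

open ComplexConjugate

/-- The quadratic form attached to a sesquilinear form is diagonal along an orthogonal family. -/
lemma re_form_sum_of_orthogonal {V ι : Type*} [AddCommGroup V] [Module ℂ V] [Fintype ι]
    (h : V →ₗ⋆[ℂ] V →ₗ[ℂ] ℂ) (v : ι → V) (hv : ∀ i j, i ≠ j → h (v i) (v j) = 0) (c : ι → ℂ) :
    (h (∑ i, c i • v i) (∑ i, c i • v i)).re = ∑ i, Complex.normSq (c i) * (h (v i) (v i)).re := by
  have key : h (∑ i, c i • v i) (∑ i, c i • v i) =
      ∑ i, (Complex.normSq (c i) : ℂ) * h (v i) (v i) := by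
    rw [map_sum h, LinearMap.sum_apply]
    refine Finset.sum_congr rfl fun i _ => ?_
    rw [map_sum, Finset.sum_eq_single i]
    · simp only [LinearMap.map_smulₛₗ, LinearMap.smul_apply, smul_eq_mul, RingHom.id_apply,
        Complex.normSq_eq_conj_mul_self]
      ring
    · intro j _ hj
      simp [hv i j hj.symm]
    · simp
  rw [key, Complex.re_sum]
  simp

/-- Sylvester's law of inertia: an orthogonal family has at most as many positive vectors as an
orthogonal basis. -/
lemma card_pos_le_of_orthogonal_basis {V ι κ : Type*} [AddCommGroup V] [Module ℂ V] [Fintype ι]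
    [Fintype κ] (h : V →ₗ⋆[ℂ] V →ₗ[ℂ] ℂ) (v : ι → V) (hv : ∀ i j, i ≠ j → h (v i) (v j) = 0)
    (b : Module.Basis κ ℂ V) (hb : ∀ i j, i ≠ j → h (b i) (b j) = 0) :
    Fintype.card {i // 0 < (h (v i) (v i)).re} ≤ Fintype.card {i // 0 < (h (b i) (b i)).re} := by
  let s : ({i // 0 < (h (v i) (v i)).re} → ℂ) →ₗ[ℂ] V :=
    Fintype.linearCombination ℂ fun i => v i
  let r : V →ₗ[ℂ] ({i // 0 < (h (b i) (b i)).re} → ℂ) :=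
    LinearMap.pi fun i => b.coord i
  have hinj : Function.Injective (r ∘ₗ s) := by
    rw [← LinearMap.ker_eq_bot, LinearMap.ker_eq_bot']
    intro c hc
    have h1 := re_form_sum_of_orthogonal h (fun i : {i // 0 < (h (v i) (v i)).re} => v i)
      (fun i j hij => hv i j fun e => hij (Subtype.ext e)) c
    have h2 := re_form_sum_of_orthogonal h b hb (b.repr (s c))
    rw [b.sum_repr] at h2
    have h3 : (h (s c) (s c)).re ≤ 0 := by
      rw [h2]
      refine Finset.sum_nonpos fun i _ => ?_
      by_cases hi : 0 < (h (b i) (b i)).re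
      · have : b.repr (s c) i = 0 := congrFun hc ⟨i, hi⟩
        simp [this]
      · exact mul_nonpos_of_nonneg_of_nonpos (Complex.normSq_nonneg _) (not_lt.mp hi)
    change (h (s c) (s c)).re = _ at h1
    have hnn : ∀ i ∈ Finset.univ, 0 ≤ Complex.normSq (c i) * (h (v i) (v i)).re :=
      fun i _ => mul_nonneg (Complex.normSq_nonneg _) i.2.le
    have h4 := (Finset.sum_eq_zero_iff_of_nonneg hnn).mp
      (le_antisymm (h1 ▸ h3) (Finset.sum_nonneg hnn))
    funext i
    have := h4 i (Finset.mem_univ i)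
    simpa [i.2.ne'] using this
  simpa using LinearMap.finrank_le_finrank_of_injective hinj

/-- Sylvester's law of inertia for orthogonal bases of a sesquilinear form. -/
lemma card_pos_eq_of_orthogonal_bases {V ι κ : Type*} [AddCommGroup V] [Module ℂ V] [Fintype ι]
    [Fintype κ] (h : V →ₗ⋆[ℂ] V →ₗ[ℂ] ℂ) (v : Module.Basis ι ℂ V)
    (hv : ∀ i j, i ≠ j → h (v i) (v j) = 0)
    (b : Module.Basis κ ℂ V) (hb : ∀ i j, i ≠ j → h (b i) (b j) = 0) :
    Fintype.card {i // 0 < (h (v i) (v i)).re} = Fintype.card {i // 0 < (h (b i) (b i)).re} :=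
  le_antisymm (card_pos_le_of_orthogonal_basis h v hv b hb)
    (card_pos_le_of_orthogonal_basis h b hb v hv)

/-- If the derivative of a Hermitian form along the flow of `T` is positive definite, then `T` is
triangular in some orthogonal basis. -/
lemma exists_orthogonal_triangular_basis {n : ℕ} {V : Type*} [AddCommGroup V] [Module ℂ V]
    [FiniteDimensional ℂ V] (hn : Module.finrank ℂ V = n) (T : V →ₗ[ℂ] V)
    (h : V →ₗ⋆[ℂ] V →ₗ[ℂ] ℂ) (hsymm : ∀ x y, h y x = conj (h x y))
    (hpos : ∀ x, x ≠ 0 → 0 < (h x (T x)).re) :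
    ∃ b : Module.Basis (Fin n) ℂ V, (∀ i j, i ≠ j → h (b i) (b j) = 0) ∧
      ∀ i j, j < i → b.repr (T (b j)) i = 0 := by
  induction n generalizing V with
  | zero =>
    exact ⟨Module.finBasisOfFinrankEq ℂ V hn, fun i => i.elim0, fun i => i.elim0⟩
  | succ n ih =>
    have : Nontrivial V := Module.nontrivial_of_finrank_pos (R := ℂ) (by omega)
    obtain ⟨μ, hμ⟩ := Module.End.exists_eigenvalue T
    obtain ⟨v, hv⟩ := hμ.exists_hasEigenvector
    have hTv : T v = μ • v := hv.apply_eq_smul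
    have hvv : h v v ≠ 0 := by
      intro h0
      have := hpos v hv.2
      simp [hTv, h0] at this
    let W : Submodule ℂ V := LinearMap.ker (h v)
    have hW : ∀ w : W, h v w = 0 := fun w => w.2
    have hW' : ∀ w : W, h w v = 0 := fun w => by rw [hsymm v, hW, map_zero]
    let π : V →ₗ[ℂ] V := LinearMap.id - (((h v v)⁻¹ • h v).smulRight v)
    have hπ : ∀ x, π x = x - ((h v v)⁻¹ * h v x) • v := fun x => rfl
    have hπW : ∀ x, π x ∈ W := fun x => by
      change h v (π x) = 0
      rw [hπ, map_sub, map_smul, smul_eq_mul]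
      field_simp
      ring
    let T' : W →ₗ[ℂ] W := (π ∘ₗ T ∘ₗ W.subtype).codRestrict W fun x => hπW _
    have hT' : ∀ w : W, T w = (T' w : V) + ((h v v)⁻¹ * h v (T w)) • v := fun w => by
      change T w = π (T w) + _
      rw [hπ, sub_add_cancel]
    have hfin : Module.finrank ℂ W = n := by
      have h1 := (h v).finrank_range_add_finrank_ker
      have h2 : LinearMap.range (h v) = ⊤ := by
        rw [LinearMap.range_eq_top]
        intro z
        exact ⟨(z * (h v v)⁻¹) • v, by rw [map_smul, smul_eq_mul]; field_simp⟩
      rw [h2, finrank_top, Module.finrank_self] at h1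
      change 1 + Module.finrank ℂ W = _ at h1
      omega
    obtain ⟨b', hb', ht'⟩ := ih hfin T' (h.domRestrict₁₂ W W) (fun x y => hsymm x y) (by
      intro w hw
      have := hpos w (by simpa using hw)
      rw [hT' w, map_add, map_smul, hW', smul_zero, add_zero] at this
      exact this)
    let b : Module.Basis (Fin (n + 1)) ℂ V := Module.Basis.mkFinCons v b'
      (fun c x hx hc => by
        have h1 : h v (c • v + x) = 0 := by rw [hc, map_zero]
        rw [map_add, map_smul, hW ⟨x, hx⟩, add_zero, smul_eq_mul] at h1
        exact (mul_eq_zero.mp h1).resolve_right hvv)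
      (fun z => ⟨-((h v v)⁻¹ * h v z), by
        have := hπW z
        rwa [hπ, sub_eq_add_neg, ← neg_smul] at this⟩)
    have hb0 : b 0 = v := by simp [b, Module.Basis.coe_mkFinCons]
    have hbs : ∀ i : Fin n, b i.succ = b' i := fun i => by simp [b, Module.Basis.coe_mkFinCons]
    have hrepr : ∀ (w : W) (i : Fin n), b.repr (w : V) i.succ = b'.repr w i := by
      intro w i
      have : (b.coord i.succ) ∘ₗ W.subtype = b'.coord i := by
        refine b'.ext fun j => ?_
        simp [← hbs, Finsupp.single_apply]
      exact LinearMap.congr_fun this w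
    have hreprv : ∀ i : Fin n, b.repr v i.succ = 0 := fun i => by
      rw [← hb0, b.repr_self]
      simp
    refine ⟨b, ?_, ?_⟩
    · intro i j hij
      induction i using Fin.cases with
      | zero =>
        induction j using Fin.cases with
        | zero => exact absurd rfl hij
        | succ j => rw [hb0, hbs]; exact hW _
      | succ i =>
        induction j using Fin.cases with
        | zero => rw [hb0, hbs]; exact hW' _
        | succ j => rw [hbs, hbs]; exact hb' i j fun e => hij (congrArg Fin.succ e)
    · intro i j hij
      induction i using Fin.cases with
      | zero => exact absurd hij (Fin.not_lt_zero j)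
      | succ i =>
        induction j using Fin.cases with
        | zero => rw [hb0, hTv, map_smul, Finsupp.smul_apply, hreprv, smul_zero]
        | succ j =>
          rw [hbs, hT', map_add, map_smul, Finsupp.add_apply, Finsupp.smul_apply, hreprv, hrepr,
            ht' i j (Fin.succ_lt_succ_iff.mp hij), smul_zero, add_zero]

/-- In a triangular basis, the eigenvalues with multiplicity are the diagonal entries. -/
lemma card_filter_roots_charpoly_of_triangular {n : ℕ} {V : Type*} [AddCommGroup V] [Module ℂ V]
    [FiniteDimensional ℂ V] (T : V →ₗ[ℂ] V) (b : Module.Basis (Fin n) ℂ V)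
    (hb : ∀ i j, j < i → b.repr (T (b j)) i = 0) (p : ℂ → Prop) :
    Multiset.card (T.charpoly.roots.filter p) = Fintype.card {i // p (b.repr (T (b i)) i)} := by
  have htri : (LinearMap.toMatrix b b T).IsUpperTriangular := fun i j hij => by
    rw [LinearMap.toMatrix_apply]
    exact hb i j hij
  rw [← T.charpoly_toMatrix b, Matrix.charpoly_of_isUpperTriangular _ htri,
    Polynomial.roots_prod _ _ (by simp [Finset.prod_ne_zero_iff, Polynomial.X_sub_C_ne_zero])]
  simp only [Polynomial.roots_X_sub_C, Multiset.bind_singleton, Multiset.filter_map,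
    Multiset.card_map, LinearMap.toMatrix_apply, Fintype.card_subtype]
  rfl

/-- The Ostrowski–Schneider inertia theorem, in terms of an orthogonal basis of the form. -/
lemma card_filter_re_roots_charpoly_eq {n : ℕ} {V : Type*} [AddCommGroup V] [Module ℂ V]
    [FiniteDimensional ℂ V] (T : V →ₗ[ℂ] V)
    (h : V →ₗ⋆[ℂ] V →ₗ[ℂ] ℂ) (hsymm : ∀ x y, h y x = conj (h x y))
    (hpos : ∀ x, x ≠ 0 → 0 < (h x (T x)).re)
    (e : Module.Basis (Fin n) ℂ V) (he : ∀ i j, i ≠ j → h (e i) (e j) = 0) :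
    Multiset.card (T.charpoly.roots.filter fun z => 0 < z.re) =
        Fintype.card {i // 0 < (h (e i) (e i)).re} ∧
      Multiset.card (T.charpoly.roots.filter fun z => z.re < 0) =
        Fintype.card {i // (h (e i) (e i)).re < 0} := by
  obtain ⟨b, hb, ht⟩ := exists_orthogonal_triangular_basis
    ((Module.finrank_eq_card_basis e).trans (Fintype.card_fin n)) T h hsymm hpos
  have hmul : ∀ i, 0 < (h (b i) (b i)).re * (b.repr (T (b i)) i).re := by
    intro i
    have h1 : h (b i) (T (b i)) = b.repr (T (b i)) i * h (b i) (b i) := by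
      conv_lhs => rw [← b.sum_repr (T (b i)), map_sum]
      rw [Finset.sum_eq_single i]
      · simp
      · intro j _ hj
        simp [hb i j hj.symm]
      · simp
    have h2 : (h (b i) (b i)).im = 0 := Complex.conj_eq_iff_im.mp (hsymm _ _).symm
    have h3 := hpos (b i) (b.ne_zero i)
    rw [h1, Complex.mul_re, h2] at h3
    linarith
  rw [card_filter_roots_charpoly_of_triangular T b ht,
    card_filter_roots_charpoly_of_triangular T b ht]
  constructor
  · rw [card_pos_eq_of_orthogonal_bases h e he b hb]
    refine Fintype.card_congr (Equiv.subtypeEquivRight fun i => ?_)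
    exact (pos_iff_pos_of_mul_pos (hmul i)).symm
  · have hneg := card_pos_eq_of_orthogonal_bases (-h) e (fun i j hij => by simp [he i j hij])
      b (fun i j hij => by simp [hb i j hij])
    simp only [LinearMap.neg_apply, Complex.neg_re, neg_pos] at hneg
    rw [hneg]
    refine Fintype.card_congr (Equiv.subtypeEquivRight fun i => ?_)
    exact (neg_iff_neg_of_mul_pos (hmul i)).symm

/-- If `T` has no purely imaginary eigenvalue, there is a Hermitian form whose derivative along the
flow of `T` is positive definite. -/
lemma exists_hermitian_form_of_re_ne_zero {n : ℕ} {V : Type*} [NormedAddCommGroup V]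
    [InnerProductSpace ℂ V] [FiniteDimensional ℂ V] (hn : Module.finrank ℂ V = n)
    (T : V →ₗ[ℂ] V) (hT : ∀ μ, Module.End.HasEigenvalue T μ → μ.re ≠ 0) :
    ∃ h : V →ₗ⋆[ℂ] V →ₗ[ℂ] ℂ, (∀ x y, h y x = conj (h x y)) ∧
      ∃ c : ℝ, 0 < c ∧ ∀ x, c * ‖x‖ ^ 2 ≤ (h x (T x)).re := by
  induction n generalizing V with
  | zero =>
    have := Module.finrank_zero_iff.mp hn
    exact ⟨0, fun x y => by simp, 1, one_pos, fun x => by simp [Subsingleton.elim x 0]⟩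
  | succ n ih =>
    have : Nontrivial V := Module.nontrivial_of_finrank_pos (R := ℂ) (by omega)
    obtain ⟨μ, hμ⟩ := Module.End.exists_eigenvalue T
    obtain ⟨v, hv1, hTv⟩ : ∃ v : V, ‖v‖ = 1 ∧ T v = μ • v := by
      obtain ⟨u, hu⟩ := hμ.exists_hasEigenvector
      refine ⟨(‖u‖⁻¹ : ℂ) • u, ?_, ?_⟩
      · have := norm_ne_zero_iff.mpr hu.2
        rw [norm_smul, norm_inv, Complex.norm_real, norm_norm, inv_mul_cancel₀ this]
      · rw [map_smul, hu.apply_eq_smul, smul_comm]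
    have hvv : inner ℂ v v = (1 : ℂ) := by simp [inner_self_eq_norm_sq_to_K, hv1]
    let φ : V →ₗ[ℂ] ℂ := innerₛₗ ℂ v
    have hφv : φ v = 1 := hvv
    have hφ : ∀ x, φ x = inner ℂ v x := fun x => rfl
    let W : Submodule ℂ V := LinearMap.ker φ
    have hφW : ∀ w : W, φ w = 0 := fun w => w.2
    let P : V →ₗ[ℂ] W := (LinearMap.id - φ.smulRight v).codRestrict W fun x => by
      change φ (x - φ x • v) = 0
      rw [map_sub, map_smul, hφv, smul_eq_mul, mul_one, sub_self]
    have hP : ∀ x, (P x : V) = x - φ x • v := fun x => rfl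
    have hdec : ∀ x, x = φ x • v + P x := fun x => by rw [hP]; abel
    have hPv : P v = 0 := Subtype.ext (by rw [hP, hφv, one_smul, sub_self]; rfl)
    have hPW : ∀ w : W, P w = w := fun w =>
      Subtype.ext (by rw [hP, hφW, zero_smul, sub_zero])
    have hnorm : ∀ x, ‖x‖ ^ 2 = ‖φ x‖ ^ 2 + ‖P x‖ ^ 2 := fun x => by
      have h0 : inner ℂ (φ x • v) (P x : V) = (0 : ℂ) := by
        rw [inner_smul_left, ← hφ, hφW, mul_zero]
      have h1 := norm_add_sq_eq_norm_sq_add_norm_sq_of_inner_eq_zero _ _ h0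
      rw [← hdec, norm_smul, hv1, mul_one] at h1
      rw [sq, sq, sq, h1]
      rfl
    let T' : W →ₗ[ℂ] W := P ∘ₗ T ∘ₗ W.subtype
    have hT' : ∀ w : W, T w = φ (T w) • v + T' w := fun w => hdec (T w)
    have hfin : Module.finrank ℂ W = n := by
      have h1 := φ.finrank_range_add_finrank_ker
      have h2 : LinearMap.range φ = ⊤ := by
        rw [LinearMap.range_eq_top]
        exact fun z => ⟨z • v, by rw [map_smul, hφv, smul_eq_mul, mul_one]⟩
      rw [h2, finrank_top, Module.finrank_self] at h1
      change 1 + Module.finrank ℂ W = _ at h1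
      omega
    have heig : ∀ ν, Module.End.HasEigenvalue T' ν → ν.re ≠ 0 := by
      intro ν hν
      by_cases hne : ν = μ
      · exact hne ▸ hT μ hμ
      obtain ⟨w, hw⟩ := hν.exists_hasEigenvector
      have hsub : ν - μ ≠ 0 := sub_ne_zero.mpr hne
      set a : ℂ := φ (T w) / (ν - μ) with ha
      refine hT ν (Module.End.hasEigenvalue_of_hasEigenvector (x := (w : V) + a • v) ⟨?_, ?_⟩)
      · rw [Module.End.mem_eigenspace_iff, map_add, map_smul, hTv, hT' w, hw.apply_eq_smul]
        have hk : φ (T w) = a * (ν - μ) := by rw [ha]; field_simp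
        rw [hk, Submodule.coe_smul]
        module
      · intro h0
        apply hw.2
        have := congrArg P h0
        rwa [map_add, map_smul, hPv, smul_zero, add_zero, hPW, map_zero] at this
    obtain ⟨h', hsymm', c, hc, hpos'⟩ := ih hfin T' heig
    set K : ℝ := ‖LinearMap.toContinuousLinearMap T‖ with hK
    set t : ℝ := c / (K ^ 2 + 1) with ht
    have htpos : 0 < t := by positivity
    have htK : t * K ^ 2 ≤ c := by
      rw [ht, div_mul_eq_mul_div, div_le_iff₀ (by positivity)]
      nlinarith
    have hμre := hT μ hμ
    let h : V →ₗ⋆[ℂ] V →ₗ[ℂ] ℂ := LinearMap.mk₂'ₛₗ (starRingEnd ℂ) (RingHom.id ℂ)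
      (fun x y => ((t * μ.re : ℝ) : ℂ) * (conj (φ x) * φ y) + h' (P x) (P y))
      (fun x x' y => by simp only [map_add, LinearMap.add_apply]; ring)
      (fun a x y => by
        simp only [map_smul, LinearMap.map_smulₛₗ, LinearMap.smul_apply, smul_eq_mul, map_mul]
        ring)
      (fun x y y' => by simp only [map_add]; ring)
      (fun a x y => by simp only [map_smul, smul_eq_mul, RingHom.id_apply]; ring)
    have hh : ∀ x y, h x y =
      ((t * μ.re : ℝ) : ℂ) * (conj (φ x) * φ y) + h' (P x) (P y) := fun x y => rfl
    refine ⟨h, fun x y => ?_, min (t * μ.re ^ 2 / 2) (c / 2), by positivity, fun x => ?_⟩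
    · rw [hh, hh, hsymm' (P x), map_add, map_mul, map_mul, Complex.conj_conj, Complex.conj_ofReal]
      ring
    · set w := P x
      have hTx : T x = (φ x * μ + φ (T w)) • v + T' w := by
        conv_lhs => rw [hdec x, map_add, map_smul, hTv, hT']
        module
      have hφTx : φ (T x) = φ x * μ + φ (T w) := by
        rw [hTx, map_add, map_smul, hφv, hφW, smul_eq_mul, mul_one, add_zero]
      have hPTx : P (T x) = T' w := by
        rw [hTx, map_add, map_smul, hPv, hPW, smul_zero, zero_add]
      have hk : ‖φ (T w)‖ ^ 2 ≤ K ^ 2 * ‖w‖ ^ 2 := by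
        have h1 : ‖φ (T w)‖ ≤ K * ‖w‖ := by
          calc ‖φ (T w)‖ ≤ ‖v‖ * ‖T w‖ := norm_inner_le_norm v (T w)
            _ = ‖LinearMap.toContinuousLinearMap T w‖ := by rw [hv1, one_mul]; rfl
            _ ≤ K * ‖w‖ := ContinuousLinearMap.le_opNorm _ _
        calc ‖φ (T w)‖ ^ 2 ≤ (K * ‖w‖) ^ 2 := by gcongr
          _ = K ^ 2 * ‖w‖ ^ 2 := by ring
      rw [hh, hφTx, hPTx, hnorm x]
      generalize φ x = a at *
      generalize φ (T w) = k at *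
      have hre : (((t * μ.re : ℝ) : ℂ) * (conj a * (a * μ + k)) + h' w (T' w)).re =
          t * (μ.re ^ 2 * ‖a‖ ^ 2 + μ.re * (a.re * k.re + a.im * k.im)) + (h' w (T' w)).re := by
        rw [Complex.add_re, Complex.re_ofReal_mul, ← Complex.normSq_eq_norm_sq,
          Complex.normSq_apply]
        simp only [Complex.mul_re, Complex.mul_im, Complex.add_re, Complex.add_im, Complex.conj_re,
          Complex.conj_im]
        ring
      have hcross : -(μ.re ^ 2 * ‖a‖ ^ 2 + ‖k‖ ^ 2) / 2 ≤
          μ.re * (a.re * k.re + a.im * k.im) := by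
        rw [← Complex.normSq_eq_norm_sq, ← Complex.normSq_eq_norm_sq, Complex.normSq_apply,
          Complex.normSq_apply]
        nlinarith [sq_nonneg (μ.re * a.re + k.re), sq_nonneg (μ.re * a.im + k.im)]
      rw [hre]
      calc min (t * μ.re ^ 2 / 2) (c / 2) * (‖a‖ ^ 2 + ‖w‖ ^ 2)
          ≤ t * μ.re ^ 2 / 2 * ‖a‖ ^ 2 + c / 2 * ‖w‖ ^ 2 := by
            rw [mul_add]
            gcongr
            · exact min_le_left _ _
            · exact min_le_right _ _
        _ ≤ t * (μ.re ^ 2 * ‖a‖ ^ 2 + -(μ.re ^ 2 * ‖a‖ ^ 2 + ‖k‖ ^ 2) / 2) + c * ‖w‖ ^ 2 := by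
            have h1 : t * ‖k‖ ^ 2 ≤ c * ‖w‖ ^ 2 := by
              calc t * ‖k‖ ^ 2 ≤ t * (K ^ 2 * ‖w‖ ^ 2) := by gcongr
                _ = t * K ^ 2 * ‖w‖ ^ 2 := by ring
                _ ≤ c * ‖w‖ ^ 2 := by gcongr
            linarith
        _ ≤ _ := by
            gcongr
            exact hpos' w

/-- The real part of the Hermitian form of a real matrix on a complex vector. -/
lemma re_inner_toEuclideanLin_map_ofReal {n : ℕ} (A : Matrix (Fin n) (Fin n) ℝ)
    (x : EuclideanSpace ℂ (Fin n)) :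
    (inner ℂ x (toEuclideanLin (A.map fun r : ℝ => (r : ℂ)) x)).re =
      (fun i => (x i).re) ⬝ᵥ A *ᵥ (fun i => (x i).re) +
        (fun i => (x i).im) ⬝ᵥ A *ᵥ (fun i => (x i).im) := by
  simp only [PiLp.inner_apply, toLpLin_apply, mulVec, dotProduct, map_apply, Complex.re_sum,
    RCLike.inner_apply, Complex.mul_re, Complex.conj_re, Complex.conj_im, Complex.im_sum,
    Complex.ofReal_re, Complex.ofReal_im, zero_mul, sub_zero, Complex.im_ofReal_mul]
  rw [← Finset.sum_add_distrib]
  refine Finset.sum_congr rfl fun i _ => ?_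
  ring

/-- The Ostrowski–Schneider inertia theorem for real matrices. -/
lemma eigCount_eq_eigCountR {n : ℕ} (G M : Matrix (Fin n) (Fin n) ℝ) (hG : G.IsSymm)
    (hpos : ∀ x, x ≠ 0 → 0 < x ⬝ᵥ (G * M) *ᵥ x) :
    eigCount (M.map (fun r : ℝ => (r : ℂ))) (fun z => 0 < z.re) = eigCountR G (fun t => 0 < t) ∧
      eigCount (M.map (fun r : ℝ => (r : ℂ))) (fun z => z.re < 0) =
        eigCountR G (fun t => t < 0) := by
  have hGc : (G.map fun r : ℝ => (r : ℂ)).IsHermitian := by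
    ext i j
    simp [hG.apply i j]
  set T := toEuclideanLin (M.map fun r : ℝ => (r : ℂ)) with hT
  set A := toEuclideanLin (G.map fun r : ℝ => (r : ℂ))
  have hAsymm : A.IsSymmetric := isSymmetric_toEuclideanLin_iff.mpr hGc
  let h : EuclideanSpace ℂ (Fin n) →ₗ⋆[ℂ] EuclideanSpace ℂ (Fin n) →ₗ[ℂ] ℂ :=
    (innerₛₗ ℂ).compl₂ A
  have hh : ∀ x y, h x y = inner ℂ x (A y) := fun x y => rfl
  let e := hGc.eigenvectorBasis
  have hAe : ∀ i, A (e i) = (hGc.eigenvalues i : ℂ) • e i := fun i => by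
    ext k
    have := congrFun (hGc.mulVec_eigenvectorBasis i) k
    simpa [A, toLpLin_apply] using this
  have hhe : ∀ i j, h (e i) (e j) = if i = j then (hGc.eigenvalues j : ℂ) else 0 := by
    intro i j
    rw [hh, hAe, inner_smul_right, orthonormal_iff_ite.mp e.orthonormal]
    simp
  have hcountR : ∀ p : ℝ → Prop, eigCountR G p = Fintype.card {i // p (hGc.eigenvalues i)} := by
    intro p
    have hchar : G.charpoly =
        ∏ i, (Polynomial.X - Polynomial.C (hGc.eigenvalues i)) := by
      apply Polynomial.map_injective Complex.ofRealHom Complex.ofRealHom.injective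
      rw [← Matrix.charpoly_map]
      refine hGc.charpoly_eq.trans ?_
      simp [Polynomial.map_prod]
    rw [eigCountR, hchar,
      Polynomial.roots_prod _ _ (by simp [Finset.prod_ne_zero_iff, Polynomial.X_sub_C_ne_zero])]
    simp only [Polynomial.roots_X_sub_C, Multiset.bind_singleton, Multiset.filter_map,
      Multiset.card_map, Fintype.card_subtype]
    rfl
  have hcount : ∀ p : ℂ → Prop, eigCount (M.map fun r : ℝ => (r : ℂ)) p =
      Multiset.card (T.charpoly.roots.filter p) := by
    intro p
    rw [eigCount, hT, toEuclideanLin_eq_toLin_orthonormal, Matrix.charpoly_toLin]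
  have key := card_filter_re_roots_charpoly_eq T h
    (fun x y => by rw [hh, hh, inner_conj_symm, hAsymm])
    (fun x hx => by
      have h1 : A (T x) = toEuclideanLin ((G * M).map fun r : ℝ => (r : ℂ)) x := by
        have : (G * M).map (fun r : ℝ => (r : ℂ)) =
            G.map (fun r : ℝ => (r : ℂ)) * M.map (fun r : ℝ => (r : ℂ)) :=
          Matrix.map_mul (f := Complex.ofRealHom)
        rw [this]
        simp [A, T, toLpLin_apply]
      rw [hh, h1, re_inner_toEuclideanLin_map_ofReal]
      have hnn : ∀ y, 0 ≤ y ⬝ᵥ (G * M) *ᵥ y := fun y => by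
        by_cases hy : y = 0
        · simp [hy]
        · exact (hpos y hy).le
      by_cases hre : (fun i => (x i).re) = 0
      · refine add_pos_of_nonneg_of_pos (hnn _) (hpos _ fun him => hx ?_)
        ext i
        exact Complex.ext (congrFun hre i) (congrFun him i)
      · exact add_pos_of_pos_of_nonneg (hpos _ hre) (hnn _))
    e.toBasis (fun i j hij => by simp [hhe, hij])
  simpa [hcount, hcountR, hhe] using key

/-- A real matrix without purely imaginary eigenvalues has a quadratic form with positive
definite derivative along its linear flow. -/
lemma exists_isSymm_of_re_ne_zero {n : ℕ} (M : Matrix (Fin n) (Fin n) ℝ)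
    (hM : ∀ z ∈ (M.map (fun r : ℝ => (r : ℂ))).charpoly.roots, z.re ≠ 0) :
    ∃ G : Matrix (Fin n) (Fin n) ℝ, G.IsSymm ∧
      ∃ c : ℝ, 0 < c ∧ ∀ x : Fin n → ℝ, c * (x ⬝ᵥ x) ≤ x ⬝ᵥ (G * M) *ᵥ x := by
  set T := toEuclideanLin (M.map fun r : ℝ => (r : ℂ)) with hT
  obtain ⟨h, hsymm, c, hc, hpos⟩ := exists_hermitian_form_of_re_ne_zero
    finrank_euclideanSpace_fin T (fun μ hμ => hM μ (by
      have hchar : (M.map fun r : ℝ => (r : ℂ)).charpoly = T.charpoly := by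
        rw [hT, toEuclideanLin_eq_toLin_orthonormal, Matrix.charpoly_toLin]
      rw [hchar, Polynomial.mem_roots T.charpoly_monic.ne_zero]
      exact (Module.End.hasEigenvalue_iff_isRoot_charpoly T μ).mp hμ))
  let e := EuclideanSpace.basisFun (Fin n) ℂ
  let G : Matrix (Fin n) (Fin n) ℝ := of fun i j => (h (e i) (e j)).re
  have hform : ∀ x y : Fin n → ℝ, (h (WithLp.toLp 2 fun i => (x i : ℂ))
      (WithLp.toLp 2 fun i => (y i : ℂ))).re = x ⬝ᵥ G *ᵥ y := by
    intro x y
    have hx : ∀ x : Fin n → ℝ, WithLp.toLp 2 (fun i => (x i : ℂ)) = ∑ i, (x i : ℂ) • e i := by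
      intro x
      rw [← e.sum_repr (WithLp.toLp 2 fun i => (x i : ℂ))]
      simp [e]
    rw [hx x, hx y, map_sum h, LinearMap.sum_apply, Complex.re_sum]
    simp only [dotProduct, mulVec]
    refine Finset.sum_congr rfl fun i _ => ?_
    rw [map_sum, Complex.re_sum, Finset.mul_sum]
    refine Finset.sum_congr rfl fun j _ => ?_
    simp only [map_smul, LinearMap.map_smulₛₗ, LinearMap.smul_apply, smul_eq_mul,
      Complex.conj_ofReal, Complex.re_ofReal_mul, G, of_apply]
    ring
  refine ⟨G, ?_, c, hc, fun x => ?_⟩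
  · ext i j
    simp [G, hsymm (e i) (e j)]
  · have h1 := hpos (WithLp.toLp 2 fun i => (x i : ℂ))
    have h2 : T (WithLp.toLp 2 fun i => (x i : ℂ)) =
        WithLp.toLp 2 fun i => ((M *ᵥ x) i : ℂ) := by
      ext i
      simp [T, toLpLin_apply, mulVec, dotProduct]
    rw [h2, hform, mulVec_mulVec, EuclideanSpace.norm_sq_eq] at h1
    simpa [dotProduct, sq] using h1

/-- Lemma 10.1: for a real `n×n` matrix `M` and `n₊ + n₋ = n`, the
following are equivalent.  (A) `M` has exactly `n₊` eigenvalues (with algebraic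
multiplicity) with positive real part and `n₋` with negative real part.  (B) There are a
real symmetric matrix `G` with exactly `n₊` positive and `n₋` negative eigenvalues and a
constant `C > 0` with `⟨GMx, x⟩ + ⟨Gx, Mx⟩ ≥ |x|²/C` for all `x ∈ ℝⁿ`. -/
theorem statement6 (n : ℕ) (M : Matrix (Fin n) (Fin n) ℝ)
    (np nm : ℕ) (hn : np + nm = n) :
    (eigCount (M.map (fun r : ℝ => (r : ℂ))) (fun z => 0 < z.re) = np ∧
     eigCount (M.map (fun r : ℝ => (r : ℂ))) (fun z => z.re < 0) = nm)
    ↔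
    ∃ G : Matrix (Fin n) (Fin n) ℝ, G.IsSymm ∧
      eigCountR G (fun t => 0 < t) = np ∧
      eigCountR G (fun t => t < 0) = nm ∧
      ∃ C : ℝ, 0 < C ∧ ∀ x : Fin n → ℝ,
        (1 / C) * (x ⬝ᵥ x) ≤ ((G * M).mulVec x) ⬝ᵥ x + (G.mulVec x) ⬝ᵥ (M.mulVec x) := by
  have hderiv : ∀ G : Matrix (Fin n) (Fin n) ℝ, G.IsSymm → ∀ x : Fin n → ℝ,
      ((G * M).mulVec x) ⬝ᵥ x + (G.mulVec x) ⬝ᵥ (M.mulVec x) = 2 * (x ⬝ᵥ (G * M) *ᵥ x) := by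
    intro G hG x
    have h1 : (G *ᵥ x) ⬝ᵥ (M *ᵥ x) = x ⬝ᵥ (G * M) *ᵥ x := by
      rw [← mulVec_mulVec, dotProduct_mulVec x G, ← mulVec_transpose, hG.eq]
    rw [h1, dotProduct_comm]
    ring
  have hxx : ∀ x : Fin n → ℝ, x ≠ 0 → 0 < x ⬝ᵥ x := fun x hx =>
    lt_of_le_of_ne (Finset.sum_nonneg fun i _ => mul_self_nonneg (x i))
      fun h0 => hx (dotProduct_self_eq_zero.mp h0.symm)
  constructor
  · rintro ⟨hp, hm⟩
    obtain ⟨G, hG, c, hc, hpos⟩ := exists_isSymm_of_re_ne_zero M (by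
      set s := (M.map (fun r : ℝ => (r : ℂ))).charpoly.roots with hs
      have hcard : Multiset.card s = n := by
        rw [hs, IsAlgClosed.card_roots_eq_natDegree, Matrix.charpoly_natDegree_eq_dim,
          Fintype.card_fin]
      change Multiset.card (s.filter fun z => 0 < z.re) = np at hp
      change Multiset.card (s.filter fun z => z.re < 0) = nm at hm
      have hor := congrArg Multiset.card
        (Multiset.filter_add_filter (fun z : ℂ => 0 < z.re) (fun z => z.re < 0) s)
      have hand : s.filter (fun z : ℂ => 0 < z.re ∧ z.re < 0) = 0 :=
        Multiset.filter_eq_nil.mpr fun z _ hz => lt_asymm hz.1 hz.2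
      rw [hand, add_zero, Multiset.card_add, hp, hm, hn, ← hcard] at hor
      have hall := Multiset.eq_of_le_of_card_le (Multiset.filter_le _ s) hor.le
      intro z hz h0
      have := Multiset.filter_eq_self.mp hall z hz
      simp [h0] at this)
    obtain ⟨h1, h2⟩ := eigCount_eq_eigCountR G M hG fun x hx =>
      (mul_pos hc (hxx x hx)).trans_le (hpos x)
    refine ⟨G, hG, h1 ▸ hp, h2 ▸ hm, 1 / (2 * c), by positivity, fun x => ?_⟩
    rw [hderiv G hG, one_div_one_div, mul_assoc]
    exact mul_le_mul_of_nonneg_left (hpos x) zero_le_two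
  · rintro ⟨G, hG, hp, hm, C, hC, hpos⟩
    obtain ⟨h1, h2⟩ := eigCount_eq_eigCountR G M hG fun x hx => by
      have h3 := hpos x
      rw [hderiv G hG] at h3
      have h4 : 0 < 1 / C * (x ⬝ᵥ x) := mul_pos (by positivity) (hxx x hx)
      linarith
    exact ⟨h1.trans hp, h2.trans hm⟩
end
end

section
/- det(λ I_{2n} − F_q) = det(λ I_n − 2AΦ) · det(λ I_n + 2AΦ) for all λ ∈ ℂ; in particular the eigenvalues of F_q, counted with multiplicity, are exactly ±2λ_1, …, ±2λ_n, where λ_1, …, λ_n are the eigenvalues of AΦ. -/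
open Matrix

noncomputable section

/-- The Hamilton matrix `F_q` of the quadratic form `q(x,ξ) = ⟨A(ξ + Φx), ξ − Φx⟩`:
`H_q(x,ξ) = (∂_ξ q, −∂_x q) = ((A − Aᵀ)Φx + (A + Aᵀ)ξ, Φ(A + Aᵀ)Φx + Φ(A − Aᵀ)ξ)`. -/
def FqA (n : ℕ) (A Φ : Matrix (Fin n) (Fin n) ℝ) :
    Matrix (Fin n ⊕ Fin n) (Fin n ⊕ Fin n) ℝ :=
  Matrix.fromBlocks ((A - Aᵀ) * Φ) (A + Aᵀ) (Φ * (A + Aᵀ) * Φ) (Φ * (A - Aᵀ))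

/-- Conjugating `F_q` by the shear `(x, ξ) ↦ (x, ξ + Φx)` makes it block upper triangular, with
diagonal blocks `2AΦ` and `-2ΦAᵀ = -(2AΦ)ᵀ`. -/
theorem charpoly_FqA (n : ℕ) (A Φ : Matrix (Fin n) (Fin n) ℝ) (hΦsymm : Φ.IsSymm) :
    (FqA n A Φ).charpoly
      = ((2 : ℝ) • (A * Φ)).charpoly * (-((2 : ℝ) • (A * Φ))).charpoly := by
  have hinv : fromBlocks 1 0 Φ 1 * fromBlocks 1 0 (-Φ) 1
      = (1 : Matrix (Fin n ⊕ Fin n) (Fin n ⊕ Fin n) ℝ) := by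
    simp [fromBlocks_multiply]
  have htri : fromBlocks 1 0 (-Φ) 1 * (FqA n A Φ * fromBlocks 1 0 Φ 1)
      = fromBlocks ((2 : ℝ) • (A * Φ)) (A + Aᵀ) 0 (-((2 : ℝ) • (A * Φ)))ᵀ := by
    rw [FqA, fromBlocks_multiply, fromBlocks_multiply, fromBlocks_inj]
    simp only [transpose_neg, two_smul, transpose_add, transpose_mul, hΦsymm.eq]
    refine ⟨?_, ?_, ?_, ?_⟩ <;> noncomm_ring
  rw [← charpoly_transpose (-((2 : ℝ) • (A * Φ))), ← charpoly_fromBlocks_zero₂₁ (M₁₂ := A + Aᵀ),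
    ← htri, charpoly_mul_comm, Matrix.mul_assoc, hinv, Matrix.mul_one]

/-- `det(λ − F_q) = det(λ − 2AΦ)·det(λ + 2AΦ)`; in particular the
eigenvalues of `F_q`, with multiplicity, are `±2λ₁, …, ±2λₙ` where `λⱼ` are the
eigenvalues of `AΦ`. -/
theorem statement9 (n : ℕ) (A Φ : Matrix (Fin n) (Fin n) ℝ)
    (hA : IsUnit A.det) (hΦsymm : Φ.IsSymm) (hΦ : IsUnit Φ.det) :
    (∀ lam : ℂ,
      Matrix.det (lam • (1 : Matrix (Fin n ⊕ Fin n) (Fin n ⊕ Fin n) ℂ)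
          - (FqA n A Φ).map (fun r : ℝ => (r : ℂ)))
        = Matrix.det (lam • (1 : Matrix (Fin n) (Fin n) ℂ)
            - ((2 : ℝ) • (A * Φ)).map (fun r : ℝ => (r : ℂ)))
          * Matrix.det (lam • (1 : Matrix (Fin n) (Fin n) ℂ)
            + ((2 : ℝ) • (A * Φ)).map (fun r : ℝ => (r : ℂ)))) ∧
    (((FqA n A Φ).map (fun r : ℝ => (r : ℂ))).charpoly.roots
      = (((2 : ℝ) • (A * Φ)).map (fun r : ℝ => (r : ℂ))).charpoly.roots
        + ((-((2 : ℝ) • (A * Φ))).map (fun r : ℝ => (r : ℂ))).charpoly.roots) := by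
  have hchar : ((FqA n A Φ).map (fun r : ℝ => (r : ℂ))).charpoly
      = (((2 : ℝ) • (A * Φ)).map (fun r : ℝ => (r : ℂ))).charpoly
        * ((-((2 : ℝ) • (A * Φ))).map (fun r : ℝ => (r : ℂ))).charpoly := by
    have h := congrArg (Polynomial.map Complex.ofRealHom) (charpoly_FqA n A Φ hΦsymm)
    rwa [Polynomial.map_mul, ← charpoly_map, ← charpoly_map, ← charpoly_map] at h
  constructor
  · intro lam
    have h := congrArg (Polynomial.eval lam) hchar
    have hneg : (-((2 : ℝ) • (A * Φ))).map (fun r : ℝ => (r : ℂ))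
        = -((2 : ℝ) • (A * Φ)).map (fun r : ℝ => (r : ℂ)) := by
      ext i j
      simp
    rwa [Polynomial.eval_mul, eval_charpoly, eval_charpoly, eval_charpoly, hneg, sub_neg_eq_add,
      scalar_apply, scalar_apply, ← smul_one_eq_diagonal, ← smul_one_eq_diagonal] at h
  · rw [hchar]
    exact Polynomial.roots_mul (mul_ne_zero (charpoly_monic _).ne_zero (charpoly_monic _).ne_zero)
end
end

section
/- Assume that, counted with algebraic multiplicity, the matrix AΦ has m_+ eigenvalues with positive real part and m_− eigenvalues with negative real part, where m_+ + m_− = n. Then there exist a real quadratic form 𝒢 on ℝ^{2n} and constants C > 0, ε_0 > 0 such that Re p⁰((x,ξ) + iε H_𝒢(x,ξ)) ≥ (ε/C) |(x,ξ)|² for all (x,ξ) ∈ ℝ^{2n} and all 0 < ε ≤ ε_0. -/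
open Matrix Complex
open scoped Classical

noncomputable section

/-- The quadratic polynomial `p⁰(x,ξ) = Σ_{j,k} A_{jk}(−iξ_k + (Φx)_k)(iξ_j + (Φx)_j)`
on `ℂⁿ × ℂⁿ`. -/
def pZero (n : ℕ) (A Φ : Matrix (Fin n) (Fin n) ℝ) (x ξ : Fin n → ℂ) : ℂ :=
  ∑ j, ∑ k, (A j k : ℂ)
    * (-Complex.I * ξ k + ((Φ.map (fun r : ℝ => (r : ℂ))).mulVec x) k)
    * (Complex.I * ξ j + ((Φ.map (fun r : ℝ => (r : ℂ))).mulVec x) j)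

/-- A functional vanishing on the common kernel of finitely many functionals is bounded by them. -/
lemma exists_normSq_le_sum_normSq {V ι : Type*} [AddCommGroup V] [Module ℂ V] [Fintype ι]
    (φ : ι → V →ₗ[ℂ] ℂ) (hφ : ∀ z, (∀ i, φ i z = 0) → z = 0) (ψ : V →ₗ[ℂ] ℂ) :
    ∃ K : ℝ, 0 ≤ K ∧ ∀ z, normSq (ψ z) ≤ K * ∑ i, normSq (φ i z) := by
  have hmem : ψ ∈ Submodule.span ℂ (Set.range φ) := by
    apply mem_span_of_iInf_ker_le_ker
    intro z hz
    have h0 : z = 0 := hφ z fun i => by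
      simpa using (Submodule.mem_iInf _).1 hz i
    simp [h0]
  obtain ⟨c, rfl⟩ := (Submodule.mem_span_range_iff_exists_fun ℂ).1 hmem
  refine ⟨∑ i, ‖c i‖ ^ 2, by positivity, fun z => ?_⟩
  simp only [LinearMap.coe_sum, Finset.sum_apply, LinearMap.smul_apply, smul_eq_mul,
    normSq_eq_norm_sq]
  calc ‖∑ i, c i * φ i z‖ ^ 2 ≤ (∑ i, ‖c i‖ * ‖φ i z‖) ^ 2 := by
        gcongr
        exact (norm_sum_le _ _).trans (by simp)
    _ ≤ _ := Finset.sum_mul_sq_le_sq_mul_sq _ _ _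

/-- The Lyapunov theorem for endomorphisms of a complex vector space without purely imaginary
eigenvalues, with the Hermitian form written as a combination of squares of functionals. -/
theorem exists_lyapunov_functionals {V : Type*} [AddCommGroup V] [Module ℂ V]
    [FiniteDimensional ℂ V] (T : Module.End ℂ V)
    (hT : ∀ μ : ℂ, μ.re = 0 → Function.Surjective (T - algebraMap ℂ (Module.End ℂ V) μ)) :
    ∃ (m : ℕ) (φ : Fin m → V →ₗ[ℂ] ℂ) (s : Fin m → ℝ), (∀ z, (∀ i, φ i z = 0) → z = 0) ∧
      ∀ z, ∑ i, normSq (φ i z) ≤ ∑ i, s i * (φ i (T z) * starRingEnd ℂ (φ i z)).re := by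
  induction h : Module.finrank ℂ V using Nat.strong_induction_on generalizing V with
  | _ n ih =>
  rcases subsingleton_or_nontrivial V with hV | hV
  · exact ⟨0, Fin.elim0, Fin.elim0, fun z _ => Subsingleton.elim _ _, fun z => by simp⟩
  obtain ⟨l, hl⟩ := Module.End.exists_eigenvalue T
  obtain ⟨v, hv⟩ := hl.exists_hasEigenvector
  have hTv : T v = l • v := hv.apply_eq_smul
  have hv0 : v ≠ 0 := hv.2
  have hl0 : l.re ≠ 0 := fun h0 => hv0 <| by
    have hinj := LinearMap.injective_iff_surjective.2 (hT l h0)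
    exact hinj (by simp [hTv])
  set W : Submodule ℂ V := ℂ ∙ v with hW
  have hWT : W ≤ W.comap T := by
    rw [hW, Submodule.span_singleton_le_iff_mem, Submodule.mem_comap, hTv]
    exact Submodule.smul_mem _ _ (Submodule.mem_span_singleton_self v)
  have hlt : Module.finrank ℂ (V ⧸ W) < n := by
    have h1 := W.finrank_quotient_add_finrank
    have h2 : Module.finrank ℂ W = 1 := finrank_span_singleton hv0
    omega
  obtain ⟨m, φ, s, hφ, hs⟩ := ih _ hlt (W.mapQ W T hWT) (fun μ hμ y => by
    obtain ⟨y, rfl⟩ := W.mkQ_surjective y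
    obtain ⟨x, rfl⟩ := hT μ hμ y
    exact ⟨W.mkQ x, by simp⟩) rfl
  obtain ⟨f, hf⟩ := Module.Projective.exists_dual_ne_zero ℂ hv0
  set ψ : V →ₗ[ℂ] ℂ := f ∘ₗ T - l • f with hψ
  have hψW : W ≤ LinearMap.ker ψ := by
    rw [hW, Submodule.span_singleton_le_iff_mem]
    simp [hψ, hTv]
  obtain ⟨K, hK, hbound⟩ := exists_normSq_le_sum_normSq φ hφ (W.liftQ ψ hψW)
  set t : ℝ := 2 / l.re with ht
  refine ⟨m + 1, Fin.cons f fun i => φ i ∘ₗ W.mkQ, Fin.cons t fun i => (1 + t ^ 2 * K) * s i,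
    fun z hz => ?_, fun z => ?_⟩
  · have h1 : W.mkQ z = 0 := hφ _ fun i => by simpa using hz i.succ
    have h2 : f z = 0 := by simpa using hz 0
    obtain ⟨a, rfl⟩ := Submodule.mem_span_singleton.1 ((Submodule.Quotient.mk_eq_zero W).1 h1)
    have : a = 0 := by simpa [hf] using h2
    simp [this]
  · have hb := hbound (W.mkQ z)
    have hq := hs (W.mkQ z)
    have hfT : f (T z) = l * f z + ψ z := by simp [hψ]
    have hlift : W.liftQ ψ hψW (W.mkQ z) = ψ z := by simp
    rw [hlift] at hb
    simp only [Fin.sum_univ_succ, Fin.cons_zero, Fin.cons_succ, LinearMap.comp_apply, mul_assoc,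
      ← Finset.mul_sum]
    have hmap : ∀ x, W.mapQ W T hWT (W.mkQ x) = W.mkQ (T x) := fun x => by simp
    simp only [hmap] at hq
    set S := ∑ i, normSq (φ i (W.mkQ z))
    set R := ∑ i, s i * (φ i (W.mkQ (T z)) * starRingEnd ℂ (φ i (W.mkQ z))).re
    have hR : (1 + t ^ 2 * K) * S ≤ (1 + t ^ 2 * K) * R := by gcongr
    have hmain : t * (f (T z) * starRingEnd ℂ (f z)).re =
        2 * normSq (f z) + t * ((ψ z).re * (f z).re + (ψ z).im * (f z).im) := by
      rw [hfT]
      simp only [ht, normSq_apply, mul_re, add_re, add_im, mul_im, conj_re, conj_im]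
      field_simp
      ring
    rw [hmain]
    have hKS : t ^ 2 * normSq (ψ z) ≤ t ^ 2 * (K * S) := by gcongr
    simp only [normSq_apply] at hKS ⊢
    nlinarith [sq_nonneg (t * (ψ z).re + 2 * (f z).re), sq_nonneg (t * (ψ z).im + 2 * (f z).im),
      sq_nonneg (t * (ψ z).re), sq_nonneg (t * (ψ z).im)]

/-- Real Lyapunov theorem: a real matrix without purely imaginary eigenvalues admits a symmetric
matrix `P` such that the symmetric part of `P * M` is positive definite. -/
theorem exists_lyapunov_matrix {n : ℕ} (M : Matrix (Fin n) (Fin n) ℝ)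
    (hM : ∀ μ ∈ (M.map (fun r : ℝ => (r : ℂ))).charpoly.roots, μ.re ≠ 0) :
    ∃ P : Matrix (Fin n) (Fin n) ℝ, P.IsSymm ∧
      ∀ x : Fin n → ℝ, x ⬝ᵥ x ≤ (M *ᵥ x) ⬝ᵥ (P *ᵥ x) := by
  set N := M.map (fun r : ℝ => (r : ℂ)) with hN
  obtain ⟨m, φ, s, hφ, hs⟩ := exists_lyapunov_functionals (Matrix.toLin' N) (fun μ hμ => by
    have hdet : N.charpoly.eval μ ≠ 0 := fun h0 =>
      hM μ ((Polynomial.mem_roots N.charpoly_monic.ne_zero).2 h0) hμ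
    rw [Matrix.eval_charpoly] at hdet
    intro y
    have hu : IsUnit (scalar (Fin n) μ - N) :=
      (Matrix.isUnit_iff_isUnit_det _).2 (isUnit_iff_ne_zero.2 hdet)
    obtain ⟨x, hx⟩ := Matrix.mulVec_surjective_iff_isUnit.2 hu (-y)
    refine ⟨x, ?_⟩
    simp only [sub_mulVec] at hx
    rw [← neg_eq_iff_eq_neg] at hx
    rw [← hx]
    ext i
    simp [Matrix.scalar_apply])
  choose K hK hbound using fun j : Fin n =>
    exists_normSq_le_sum_normSq φ hφ (LinearMap.proj j)
  set e : Fin n → Fin n → ℂ := fun j => Pi.single j 1 with he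
  set P : Matrix (Fin n) (Fin n) ℝ := Matrix.of fun a b =>
    ∑ i, s i * (φ i (e a) * starRingEnd ℂ (φ i (e b))).re with hP
  have hexp : ∀ i (x : Fin n → ℝ), φ i (fun j => (x j : ℂ)) = ∑ j, (x j : ℂ) * φ i (e j) := by
    intro i x
    have : (fun j => (x j : ℂ)) = ∑ j, (x j : ℂ) • e j := by
      ext k
      simp [he, Finset.sum_apply, Pi.single_apply]
    rw [this, map_sum]
    simp
  have hPform : ∀ y x : Fin n → ℝ, y ⬝ᵥ (P *ᵥ x) =
      ∑ i, s i * (φ i (fun j => (y j : ℂ)) * starRingEnd ℂ (φ i (fun j => (x j : ℂ)))).re := by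
    intro y x
    have hterm : ∀ i, (φ i (fun j => (y j : ℂ)) *
        starRingEnd ℂ (φ i (fun j => (x j : ℂ)))).re =
        ∑ a, ∑ b, y a * x b * (φ i (e a) * starRingEnd ℂ (φ i (e b))).re := by
      intro i
      rw [hexp, hexp, map_sum, Finset.sum_mul_sum, re_sum]
      refine Finset.sum_congr rfl fun a _ => ?_
      rw [re_sum]
      refine Finset.sum_congr rfl fun b _ => ?_
      rw [map_mul, conj_ofReal, ← re_ofReal_mul, ofReal_mul]
      congr 1
      ring
    simp only [hterm, Finset.mul_sum]
    rw [Finset.sum_comm]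
    refine Finset.sum_congr rfl fun a _ => ?_
    rw [Finset.sum_comm, mulVec, dotProduct, Finset.mul_sum]
    refine Finset.sum_congr rfl fun b _ => ?_
    simp only [hP, Matrix.of_apply, Finset.sum_mul, Finset.mul_sum]
    exact Finset.sum_congr rfl fun i _ => by ring
  refine ⟨(∑ j, K j) • P, ?_, fun x => ?_⟩
  · ext a b
    simp only [hP, transpose_apply, Matrix.smul_apply, of_apply, mul_re, conj_re, conj_im,
      smul_eq_mul]
    congr 1
    exact Finset.sum_congr rfl fun i _ => by ring
  · have hx := hs (fun j => (x j : ℂ))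
    have hNx : Matrix.toLin' N (fun j => (x j : ℂ)) = fun j => ((M *ᵥ x) j : ℂ) := by
      ext j
      simp [hN, mulVec, dotProduct]
    rw [hNx, ← hPform] at hx
    rw [smul_mulVec, dotProduct_smul, smul_eq_mul]
    calc x ⬝ᵥ x = ∑ j, normSq (x j : ℂ) := by simp [dotProduct, normSq_ofReal]
      _ ≤ ∑ j, K j * ∑ i, normSq (φ i fun j => (x j : ℂ)) :=
        Finset.sum_le_sum fun j _ => hbound j fun j => (x j : ℂ)
      _ = (∑ j, K j) * ∑ i, normSq (φ i fun j => (x j : ℂ)) := by rw [Finset.sum_mul]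
      _ ≤ _ := mul_le_mul_of_nonneg_left hx (Finset.sum_nonneg fun j _ => hK j)

lemma exists_dotProduct_mulVec_le {ι : Type*} [Fintype ι] (N : Matrix ι ι ℝ) :
    ∃ K : ℝ, 0 ≤ K ∧ ∀ x : ι → ℝ, x ⬝ᵥ (N *ᵥ x) ≤ K * (x ⬝ᵥ x) := by
  refine ⟨∑ i, ∑ j, |N i j|, by positivity, fun x => ?_⟩
  have hle : ∀ i, x i ^ 2 ≤ x ⬝ᵥ x := fun i => by
    rw [dotProduct, sq]
    exact Finset.single_le_sum (f := fun i => x i * x i) (fun i _ => mul_self_nonneg _)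
      (Finset.mem_univ i)
  rw [Finset.sum_mul, dotProduct]
  refine Finset.sum_le_sum fun i _ => ?_
  rw [Finset.sum_mul, mulVec, dotProduct, Finset.mul_sum]
  refine Finset.sum_le_sum fun j _ => ?_
  change x i * (N i j * x j) ≤ |N i j| * (x ⬝ᵥ x)
  have hxx : |x i * x j| ≤ x ⬝ᵥ x := by
    rw [abs_le]
    constructor <;> nlinarith [hle i, hle j, sq_nonneg (x i + x j), sq_nonneg (x i - x j)]
  calc x i * (N i j * x j) = N i j * (x i * x j) := by ring
    _ ≤ |N i j * (x i * x j)| := le_abs_self _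
    _ = |N i j| * |x i * x j| := abs_mul _ _
    _ ≤ _ := by gcongr

lemma pZero_re_add_I_mul {n : ℕ} (A Φ : Matrix (Fin n) (Fin n) ℝ) (ε : ℝ) (x ξ y η : Fin n → ℝ) :
    (pZero n A Φ (fun j => (x j : ℂ) + (ε : ℂ) * Complex.I * (y j : ℂ))
      (fun j => (ξ j : ℂ) + (ε : ℂ) * Complex.I * (η j : ℂ))).re =
    (Φ *ᵥ x - ε • η) ⬝ᵥ (A *ᵥ (Φ *ᵥ x + ε • η)) +
      (ξ + ε • (Φ *ᵥ y)) ⬝ᵥ (A *ᵥ (ξ - ε • (Φ *ᵥ y))) := by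
  have hΦ : ∀ k, ((Φ.map (fun r : ℝ => (r : ℂ))).mulVec
      (fun j => (x j : ℂ) + (ε : ℂ) * Complex.I * (y j : ℂ))) k =
      ((Φ *ᵥ x) k : ℂ) + (ε : ℂ) * Complex.I * ((Φ *ᵥ y) k : ℂ) := by
    intro k
    simp only [mulVec, dotProduct, map_apply, ofReal_sum, Finset.mul_sum, ← Finset.sum_add_distrib,
      ofReal_mul]
    exact Finset.sum_congr rfl fun j _ => by ring
  simp only [pZero, hΦ, re_sum]
  have hA : ∀ (v : Fin n → ℝ) j, (A *ᵥ v) j = ∑ k, A j k * v k := fun _ _ => rfl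
  simp only [dotProduct, hA, Finset.mul_sum, ← Finset.sum_add_distrib]
  refine Finset.sum_congr rfl fun j _ => Finset.sum_congr rfl fun k _ => ?_
  simp
  ring

lemma re_ne_zero_of_eigCount {n : ℕ} (M : Matrix (Fin n) (Fin n) ℂ)
    (h : eigCount M (fun z => 0 < z.re) + eigCount M (fun z => z.re < 0) = n) :
    ∀ μ ∈ M.charpoly.roots, μ.re ≠ 0 := by
  have hcard : Multiset.card M.charpoly.roots = n := by
    rw [← (IsAlgClosed.splits M.charpoly).natDegree_eq_card_roots, Matrix.charpoly_natDegree_eq_dim,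
      Fintype.card_fin]
  simp only [eigCount] at h
  rw [← Multiset.card_add, Multiset.filter_add_filter] at h
  have hnone : Multiset.filter (fun z : ℂ => 0 < z.re ∧ z.re < 0) M.charpoly.roots = 0 :=
    Multiset.filter_eq_nil.2 fun z _ hz => lt_asymm hz.1 hz.2
  rw [hnone, add_zero] at h
  have heq := Multiset.eq_of_le_of_card_le (Multiset.filter_le _ _) (hcard.trans h.symm).le
  intro μ hμ h0
  have := Multiset.filter_eq_self.1 heq μ hμ
  simp [h0] at this

/-- Lower bound obtained from nonnegativity of the symmetric part of `A` at `u - ε • w`. -/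
lemma mul_dotProduct_sub_le_of_posSemidef {n : ℕ} {A : Matrix (Fin n) (Fin n) ℝ}
    (hB : (((1 : ℝ) / 2) • (A + Aᵀ)).PosSemidef) (ε : ℝ) (u w : Fin n → ℝ) :
    2 * ε * (w ⬝ᵥ (A *ᵥ u)) - 2 * ε ^ 2 * (w ⬝ᵥ (A *ᵥ w)) ≤
      (u + ε • w) ⬝ᵥ (A *ᵥ (u - ε • w)) := by
  have h := hB.dotProduct_mulVec_nonneg (u - ε • w)
  have hT : ∀ z : Fin n → ℝ, z ⬝ᵥ (Aᵀ *ᵥ z) = z ⬝ᵥ (A *ᵥ z) := fun z => by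
    rw [mulVec_transpose, dotProduct_comm, ← dotProduct_mulVec]
  simp only [star_trivial, smul_mulVec, add_mulVec, dotProduct_smul, dotProduct_add, hT,
    smul_eq_mul] at h
  simp only [mulVec_sub, mulVec_smul, dotProduct_sub, sub_dotProduct, add_dotProduct,
    smul_dotProduct, dotProduct_smul, smul_eq_mul] at h ⊢
  nlinarith

/-- (Proposition 9.2 a)): if `AΦ` has `m₊` eigenvalues with positive and
`m₋` with negative real part, `m₊ + m₋ = n`, then there is a real quadratic form `𝒢`
(with symmetric matrix `G`, `𝒢(ρ) = ⟨Gρ, ρ⟩`, Hamilton field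
`H_𝒢(x,ξ) = (2(Gρ)_ξ, −2(Gρ)_x)`) such that
`Re p⁰((x,ξ) + iεH_𝒢(x,ξ)) ≥ (ε/C)|(x,ξ)|²` for all `(x,ξ)` and all small `ε > 0`. -/
theorem statement10 (n : ℕ) (A Φ : Matrix (Fin n) (Fin n) ℝ)
    (hA : IsUnit A.det)
    (hB : (((1 : ℝ) / 2) • (A + Aᵀ)).PosSemidef)
    (hΦsymm : Φ.IsSymm) (hΦ : IsUnit Φ.det)
    (mp mm : ℕ) (hm : mp + mm = n)
    (hcount : eigCount ((A * Φ).map (fun r : ℝ => (r : ℂ))) (fun z => 0 < z.re) = mp ∧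
      eigCount ((A * Φ).map (fun r : ℝ => (r : ℂ))) (fun z => z.re < 0) = mm) :
    ∃ G : Matrix (Fin n ⊕ Fin n) (Fin n ⊕ Fin n) ℝ, G.IsSymm ∧
      ∃ C : ℝ, 0 < C ∧ ∃ ε0 : ℝ, 0 < ε0 ∧
        ∀ ε : ℝ, 0 < ε → ε ≤ ε0 → ∀ x ξ : Fin n → ℝ,
          (ε / C) * ((∑ j, (x j) ^ 2) + ∑ j, (ξ j) ^ 2)
            ≤ (pZero n A Φ
                (fun j => (x j : ℂ)
                  + (ε : ℂ) * Complex.I * (2 * (G.mulVec (Sum.elim x ξ)) (Sum.inr j)))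
                (fun j => (ξ j : ℂ)
                  + (ε : ℂ) * Complex.I * (-2 * (G.mulVec (Sum.elim x ξ)) (Sum.inl j)))).re := by
  have hre := re_ne_zero_of_eigCount _ (by rw [hcount.1, hcount.2, hm])
  obtain ⟨P, hPs, hP⟩ := exists_lyapunov_matrix (A * Φ) hre
  obtain ⟨Q, hQs, hQ⟩ := exists_lyapunov_matrix (Φ * A) (by
    have hmap : ∀ X Y : Matrix (Fin n) (Fin n) ℝ, (X * Y).map (fun r : ℝ => (r : ℂ)) =
        X.map (fun r : ℝ => (r : ℂ)) * Y.map (fun r : ℝ => (r : ℂ)) := fun X Y =>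
      Matrix.map_mul (f := Complex.ofRealHom)
    rw [hmap, Matrix.charpoly_mul_comm, ← hmap]
    exact hre)
  obtain ⟨K, hK, hKP⟩ := exists_dotProduct_mulVec_le (Pᵀ * A * P)
  obtain ⟨L, hL, hLQ⟩ := exists_dotProduct_mulVec_le ((Φ * Q)ᵀ * A * (Φ * Q))
  refine ⟨Matrix.fromBlocks ((1 / 2 : ℝ) • P) 0 0 ((1 / 2 : ℝ) • Q), ?_, 1, one_pos,
    1 / (2 * (K + L + 1)), by positivity, fun ε hε hε0 x ξ => ?_⟩
  · exact Matrix.IsSymm.fromBlocks (hPs.smul _) (by simp) (hQs.smul _)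
  have hy : ∀ j, (2 * (((Matrix.fromBlocks ((1 / 2 : ℝ) • P) 0 0 ((1 / 2 : ℝ) • Q)).mulVec
      (Sum.elim x ξ)) (Sum.inr j) : ℂ)) = ((Q *ᵥ ξ) j : ℝ) := fun j => by
    simp [fromBlocks_mulVec, smul_mulVec]
  have hη : ∀ j, (-2 * (((Matrix.fromBlocks ((1 / 2 : ℝ) • P) 0 0 ((1 / 2 : ℝ) • Q)).mulVec
      (Sum.elim x ξ)) (Sum.inl j) : ℂ)) = ((-(P *ᵥ x)) j : ℝ) := fun j => by
    simp [fromBlocks_mulVec, smul_mulVec]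
  simp only [hy, hη]
  rw [pZero_re_add_I_mul]
  have h1 := mul_dotProduct_sub_le_of_posSemidef hB ε (Φ *ᵥ x) (P *ᵥ x)
  have h2 := mul_dotProduct_sub_le_of_posSemidef hB ε ξ (Φ *ᵥ (Q *ᵥ ξ))
  have hPx := hP x
  have hQξ := hQ ξ
  have hKx := hKP x
  have hLξ := hLQ ξ
  have hsx : ∑ j, x j ^ 2 = x ⬝ᵥ x := by simp [dotProduct, sq]
  have hsξ : ∑ j, ξ j ^ 2 = ξ ⬝ᵥ ξ := by simp [dotProduct, sq]
  have hx0 : 0 ≤ x ⬝ᵥ x := hsx ▸ by positivity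
  have hξ0 : 0 ≤ ξ ⬝ᵥ ξ := hsξ ▸ by positivity
  have e1 : x ⬝ᵥ ((Pᵀ * A * P) *ᵥ x) = (P *ᵥ x) ⬝ᵥ (A *ᵥ (P *ᵥ x)) := by
    rw [← mulVec_mulVec, ← mulVec_mulVec, dotProduct_mulVec, vecMul_transpose]
  have e2 : ξ ⬝ᵥ (((Φ * Q)ᵀ * A * (Φ * Q)) *ᵥ ξ) =
      (Φ *ᵥ (Q *ᵥ ξ)) ⬝ᵥ (A *ᵥ (Φ *ᵥ (Q *ᵥ ξ))) := by
    rw [← mulVec_mulVec, ← mulVec_mulVec, dotProduct_mulVec, vecMul_transpose, ← mulVec_mulVec]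
  have e3 : ((A * Φ) *ᵥ x) ⬝ᵥ (P *ᵥ x) = (P *ᵥ x) ⬝ᵥ (A *ᵥ (Φ *ᵥ x)) := by
    rw [← mulVec_mulVec, dotProduct_comm]
  have e4 : ((Φ * A) *ᵥ ξ) ⬝ᵥ (Q *ᵥ ξ) = (Φ *ᵥ (Q *ᵥ ξ)) ⬝ᵥ (A *ᵥ ξ) := by
    rw [← mulVec_mulVec, dotProduct_comm, dotProduct_mulVec, ← mulVec_transpose, hΦsymm.eq]
  rw [e1] at hKx
  rw [e2] at hLξ
  rw [e3] at hPx
  rw [e4] at hQξ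
  rw [smul_neg, sub_neg_eq_add, ← sub_eq_add_neg, hsx, hsξ, div_one]
  have hεK : 2 * ε * (K + L + 1) ≤ 1 := by
    rw [le_div_iff₀ (by positivity)] at hε0
    linarith
  have hquad : 2 * ε ^ 2 * (K * (x ⬝ᵥ x) + L * (ξ ⬝ᵥ ξ)) ≤ ε * (x ⬝ᵥ x + ξ ⬝ᵥ ξ) := by
    have hb : K * (x ⬝ᵥ x) + L * (ξ ⬝ᵥ ξ) ≤ (K + L + 1) * (x ⬝ᵥ x + ξ ⬝ᵥ ξ) := by
      nlinarith [mul_nonneg hK hξ0, mul_nonneg hL hx0]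
    calc 2 * ε ^ 2 * (K * (x ⬝ᵥ x) + L * (ξ ⬝ᵥ ξ))
        ≤ 2 * ε ^ 2 * ((K + L + 1) * (x ⬝ᵥ x + ξ ⬝ᵥ ξ)) := by gcongr
      _ = (2 * ε * (K + L + 1)) * (ε * (x ⬝ᵥ x + ξ ⬝ᵥ ξ)) := by ring
      _ ≤ 1 * (ε * (x ⬝ᵥ x + ξ ⬝ᵥ ξ)) := by gcongr
      _ = _ := one_mul _
  have hε2 : (0 : ℝ) ≤ 2 * ε ^ 2 := by positivity
  have k1 := mul_le_mul_of_nonneg_left hPx (by positivity : 0 ≤ 2 * ε)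
  have k2 := mul_le_mul_of_nonneg_left hQξ (by positivity : 0 ≤ 2 * ε)
  have k3 := mul_le_mul_of_nonneg_left hKx hε2
  have k4 := mul_le_mul_of_nonneg_left hLξ hε2
  linarith
end
end

section
/- Assume there exist a real quadratic form 𝒢 on ℝ^{2n} and constants C > 0, ε_0 > 0 such that Re p⁰((x,ξ) + iε H_𝒢(x,ξ)) ≥ (ε/C) |(x,ξ)|² for all (x,ξ) ∈ ℝ^{2n} and all 0 < ε ≤ ε_0. Then, counted with algebraic multiplicity, AΦ has exactly n_+ eigenvalues with positive real part and exactly n_− eigenvalues with negative real part, where (n_+, n_−) is the signature of Φ. -/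
open Matrix Complex
open scoped Classical

noncomputable section

open Filter Topology Module

theorem tendsto_pow_mul_exp_mul_atBot {μ : ℂ} (hμ : 0 < μ.re) (j : ℕ) :
    Tendsto (fun t : ℝ => ((t ^ j / j.factorial : ℝ) : ℂ) * cexp (t * μ)) atBot (𝓝 0) := by
  have h1 : Tendsto (fun t : ℝ => (μ.re * t) ^ j * Real.exp (-(μ.re * t))) atTop (𝓝 0) :=
    (Real.tendsto_pow_mul_exp_neg_atTop_nhds_zero j).comp (tendsto_id.const_mul_atTop hμ)
  have h2 := (h1.comp tendsto_neg_atBot_atTop).const_mul ((μ.re ^ j * j.factorial)⁻¹)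
  rw [mul_zero] at h2
  rw [tendsto_zero_iff_norm_tendsto_zero]
  refine (tendsto_zero_iff_norm_tendsto_zero.mp h2).congr fun t => ?_
  simp [Complex.norm_exp, mul_pow, abs_of_pos hμ, mul_comm t]
  field_simp

/-- The subspace of initial values of trajectories of `φ' = f φ` which tend to `0` at `-∞`. -/
def unstableSubmodule {E : Type*} [NormedAddCommGroup E] [NormedSpace ℂ E] (f : End ℂ E) :
    Submodule ℂ E where
  carrier := {v | ∃ φ : ℝ → E, φ 0 = v ∧ (∀ t, HasDerivAt φ (f (φ t)) t) ∧ Tendsto φ atBot (𝓝 0)}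
  zero_mem' := ⟨fun _ => 0, rfl, fun t => by simpa using hasDerivAt_const t (0 : E),
    tendsto_const_nhds⟩
  add_mem' := by
    rintro _ _ ⟨φ, rfl, hφ, hφ0⟩ ⟨ψ, rfl, hψ, hψ0⟩
    exact ⟨fun t => φ t + ψ t, rfl, fun t => by rw [map_add]; exact (hφ t).add (hψ t),
      by simpa using hφ0.add hψ0⟩
  smul_mem' := by
    rintro c _ ⟨φ, rfl, hφ, hφ0⟩
    exact ⟨fun t => c • φ t, rfl, fun t => by rw [map_smul]; exact (hφ t).const_smul c,
      by simpa using hφ0.const_smul c⟩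

theorem hasDerivAt_sum_pow_div_factorial_smul {E : Type*} [NormedAddCommGroup E] [NormedSpace ℂ E]
    (N : End ℂ E) (v : E) (k : ℕ) (t : ℝ) :
    HasDerivAt (fun t : ℝ => ∑ j ∈ Finset.range (k + 1),
        ((t ^ j / j.factorial : ℝ) : ℂ) • (N ^ j) v)
      (N (∑ j ∈ Finset.range k, ((t ^ j / j.factorial : ℝ) : ℂ) • (N ^ j) v)) t := by
  induction k with
  | zero => simpa using hasDerivAt_const t v
  | succ k ih =>
    simp only [Finset.sum_range_succ _ (k + 1)]
    rw [Finset.sum_range_succ _ k, map_add]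
    refine ih.add ?_
    have h : HasDerivAt (fun t : ℝ => t ^ (k + 1) / ((k + 1).factorial : ℝ))
        (t ^ k / k.factorial) t := by
      refine ((hasDerivAt_pow (k + 1) t).div_const ((k + 1).factorial : ℝ)).congr_deriv ?_
      rw [Nat.factorial_succ]
      push_cast
      field_simp
    rw [map_smul, ← Module.End.mul_apply, ← pow_succ']
    exact h.ofReal_comp.smul_const _

theorem maxGenEigenspace_le_unstableSubmodule {E : Type*} [NormedAddCommGroup E] [NormedSpace ℂ E]
    (f : End ℂ E) {μ : ℂ} (hμ : 0 < μ.re) : f.maxGenEigenspace μ ≤ unstableSubmodule f := by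
  intro v hv
  obtain ⟨k, hk⟩ := (End.mem_maxGenEigenspace f μ v).mp hv
  set N : End ℂ E := f - μ • 1 with hN
  refine ⟨fun t => cexp (t * μ) • ∑ j ∈ Finset.range (k + 1),
    ((t ^ j / j.factorial : ℝ) : ℂ) • (N ^ j) v, ?_, fun t => ?_, ?_⟩
  · simp [Finset.sum_range_succ']
  · have he : HasDerivAt (fun t : ℝ => cexp (t * μ)) (cexp (t * μ) * μ) t := by
      simpa using (((hasDerivAt_id t).ofReal_comp).mul_const μ).cexp
    refine (he.smul (hasDerivAt_sum_pow_div_factorial_smul N v k t)).congr_deriv ?_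
    have hs : ∑ j ∈ Finset.range k, ((t ^ j / j.factorial : ℝ) : ℂ) • (N ^ j) v
        = ∑ j ∈ Finset.range (k + 1), ((t ^ j / j.factorial : ℝ) : ℂ) • (N ^ j) v := by
      rw [Finset.sum_range_succ, hk, smul_zero, add_zero]
    rw [hs, map_smul]
    generalize (∑ j ∈ Finset.range (k + 1), ((t ^ j / j.factorial : ℝ) : ℂ) • (N ^ j) v) = w
    simp [hN, smul_sub, smul_smul]
  · simp only [Finset.smul_sum, smul_smul]
    rw [← Finset.sum_const_zero (s := Finset.range (k + 1)) (ι := ℕ)]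
    refine tendsto_finsetSum _ fun j _ => ?_
    have := (tendsto_pow_mul_exp_mul_atBot hμ j).smul_const ((N ^ j) v)
    simpa only [zero_smul, mul_comm] using this

theorem maxGenEigenspace_neg_neg {K V : Type*} [Field K] [AddCommGroup V] [Module K V]
    (f : End K V) (μ : K) : (-f).maxGenEigenspace (-μ) = f.maxGenEigenspace μ := by
  ext v
  have h : -f - (-μ) • (1 : End K V) = -(f - μ • 1) := by
    rw [neg_smul]; abel
  simp only [End.mem_maxGenEigenspace, h]
  refine exists_congr fun k => ?_
  rcases Nat.even_or_odd k with hk | hk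
  · rw [hk.neg_pow]
  · rw [hk.neg_pow, LinearMap.neg_apply, neg_eq_zero]

theorem card_filter_roots_charpoly_le_finrank {K V : Type*} [Field K] [AddCommGroup V] [Module K V]
    [FiniteDimensional K V] (f : End K V) (p : K → Prop) (W : Submodule K V)
    (hW : ∀ μ, p μ → f.maxGenEigenspace μ ≤ W) :
    Multiset.card (f.charpoly.roots.filter p) ≤ finrank K W := by
  set s := (f.charpoly.roots.filter p).toFinset with hs
  have hp : ∀ μ ∈ s, p μ := fun μ hμ => by
    simp only [hs, Multiset.mem_toFinset, Multiset.mem_filter] at hμ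
    exact hμ.2
  have hcard : Multiset.card (f.charpoly.roots.filter p)
      = finrank K (Π μ : s, f.maxGenEigenspace μ) := by
    rw [finrank_pi_fintype, ← Multiset.toFinset_sum_count_eq, ← hs, ← Finset.sum_coe_sort s]
    refine Finset.sum_congr rfl fun μ _ => ?_
    rw [Multiset.count_filter_of_pos (hp μ μ.2), Polynomial.count_roots,
      LinearMap.finrank_maxGenEigenspace_eq]
  rw [hcard]
  let g : (Π μ : s, f.maxGenEigenspace μ) →ₗ[K] W :=
    ∑ μ : s, (Submodule.inclusion (hW μ (hp μ μ.2))) ∘ₗ LinearMap.proj μ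
  refine LinearMap.finrank_le_finrank_of_injective (f := g) ?_
  rw [injective_iff_map_eq_zero]
  intro v hv
  have hind : iSupIndep fun μ : s => f.maxGenEigenspace (μ : K) :=
    f.independent_maxGenEigenspace.comp Subtype.val_injective
  have h0 : ∑ μ : s, (v μ : V) = 0 := by
    have := congrArg (Subtype.val) hv
    simpa [g] using this
  have h1 := iSupIndep_iff_finsetSum_eq_zero_imp_eq_zero _ |>.mp hind Finset.univ
    (fun μ => (v μ : V)) (fun μ _ => (v μ).2) h0
  ext μ
  exact h1 μ (Finset.mem_univ μ)

theorem nonneg_of_mem_unstableSubmodule {n : ℕ} (M S : Matrix (Fin n) (Fin n) ℂ)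
    (hS : S.IsHermitian) (h : ∀ v, 0 ≤ (star v ⬝ᵥ (S * M) *ᵥ v).re) {v : Fin n → ℂ}
    (hv : v ∈ unstableSubmodule M.toLin') : 0 ≤ (star v ⬝ᵥ S *ᵥ v).re := by
  obtain ⟨φ, rfl, hφ, hφ0⟩ := hv
  have hd : ∀ t, HasDerivAt (fun t => (star (φ t) ⬝ᵥ S *ᵥ φ t).re)
      (2 * (star (φ t) ⬝ᵥ (S * M) *ᵥ φ t).re) t := by
    intro t
    have hSφ : HasDerivAt (fun t => S *ᵥ φ t) (S *ᵥ M *ᵥ φ t) t :=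
      (LinearMap.toContinuousLinearMap (S.toLin'.restrictScalars ℝ)).hasFDerivAt.comp_hasDerivAt t
        (hφ t)
    have h1 : HasDerivAt (fun t => star (φ t) ⬝ᵥ S *ᵥ φ t)
        (star (M *ᵥ φ t) ⬝ᵥ S *ᵥ φ t + star (φ t) ⬝ᵥ S *ᵥ M *ᵥ φ t) t := by
      simp only [dotProduct, ← Finset.sum_add_distrib]
      exact HasDerivAt.fun_sum fun i _ =>
        ((hasDerivAt_pi.mp (hφ t) i).star).mul (hasDerivAt_pi.mp hSφ i)
    refine (Complex.reCLM.hasFDerivAt.comp_hasDerivAt t h1).congr_deriv ?_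
    have h2 : star (M *ᵥ φ t) ⬝ᵥ S *ᵥ φ t = star (star (φ t) ⬝ᵥ S *ᵥ M *ᵥ φ t) := by
      rw [Matrix.star_dotProduct, star_mulVec S, hS.eq, ← dotProduct_mulVec]
    rw [h2, ← mulVec_mulVec]
    simp [two_mul]
  have hmono : Monotone (fun t => (star (φ t) ⬝ᵥ S *ᵥ φ t).re) :=
    monotone_of_hasDerivAt_nonneg hd fun t => by have := h (φ t); positivity
  have hc : Continuous fun w : Fin n → ℂ => (star w ⬝ᵥ S *ᵥ w).re := by fun_prop
  have hlim : Tendsto (fun t => (star (φ t) ⬝ᵥ S *ᵥ φ t).re) atBot (𝓝 0) := by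
    simpa [Function.comp_def] using (hc.tendsto 0).comp hφ0
  exact hmono.le_of_tendsto hlim 0

theorem star_dotProduct_mulVec_eq_sum_eigenvalues {n : ℕ} {S : Matrix (Fin n) (Fin n) ℂ}
    (hS : S.IsHermitian) (v : Fin n → ℂ) :
    (star v ⬝ᵥ S *ᵥ v).re = ∑ i, hS.eigenvalues i *
      Complex.normSq ((star (hS.eigenvectorUnitary : Matrix (Fin n) (Fin n) ℂ) *ᵥ v) i) := by
  set U : Matrix (Fin n) (Fin n) ℂ := (hS.eigenvectorUnitary).1 with hU
  have hspec : S = U * diagonal (RCLike.ofReal ∘ hS.eigenvalues) * star U := by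
    conv_lhs => rw [hS.spectral_theorem, Unitary.conjStarAlgAut_apply]
  conv_lhs => rw [hspec]
  have h : star v ᵥ* U = star (star U *ᵥ v) := by
    rw [star_mulVec, star_eq_conjTranspose, conjTranspose_conjTranspose]
  rw [← mulVec_mulVec, ← mulVec_mulVec, dotProduct_mulVec, h]
  generalize star U *ᵥ v = w
  simp only [dotProduct, mulVec_diagonal, Complex.re_sum]
  refine Finset.sum_congr rfl fun i _ => ?_
  simp [Complex.normSq_apply]
  ring

theorem finrank_le_card_eigenvalues {n : ℕ} {S : Matrix (Fin n) (Fin n) ℂ} (hS : S.IsHermitian)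
    (hdet : S.det ≠ 0) {σ : ℝ} (hσ : σ ≠ 0) (W : Submodule ℂ (Fin n → ℂ))
    (hW : ∀ v ∈ W, 0 ≤ σ * (star v ⬝ᵥ S *ᵥ v).re) :
    finrank ℂ W ≤ Fintype.card {i // 0 < σ * hS.eigenvalues i} := by
  set U : Matrix (Fin n) (Fin n) ℂ := (hS.eigenvectorUnitary).1 with hU
  rw [← Module.finrank_fintype_fun_eq_card ℂ]
  let g : W →ₗ[ℂ] ({i // 0 < σ * hS.eigenvalues i} → ℂ) :=
    LinearMap.funLeft ℂ ℂ Subtype.val ∘ₗ (star U).toLin' ∘ₗ W.subtype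
  refine LinearMap.finrank_le_finrank_of_injective (f := g) ?_
  rw [injective_iff_map_eq_zero]
  rintro ⟨v, hv⟩ hgv
  have hpos : ∀ i, 0 < σ * hS.eigenvalues i → (star U *ᵥ v) i = 0 := fun i hi =>
    congrFun hgv ⟨i, hi⟩
  have hne : ∀ i, hS.eigenvalues i ≠ 0 := fun i hi => hdet <| by
    rw [hS.det_eq_prod_eigenvalues]
    exact Finset.prod_eq_zero (Finset.mem_univ i) (by simp [hi])
  have hle : ∀ i ∈ Finset.univ,
      σ * (hS.eigenvalues i * Complex.normSq ((star U *ᵥ v) i)) ≤ 0 := by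
    intro i _
    by_cases hi : 0 < σ * hS.eigenvalues i
    · simp [hpos i hi]
    · rw [← mul_assoc]
      exact mul_nonpos_of_nonpos_of_nonneg (not_lt.mp hi) (Complex.normSq_nonneg _)
  have hsum := hW v hv
  rw [star_dotProduct_mulVec_eq_sum_eigenvalues hS, Finset.mul_sum] at hsum
  have hz := (Finset.sum_eq_zero_iff_of_nonpos hle).mp (le_antisymm (Finset.sum_nonpos hle) hsum)
  have hw : star U *ᵥ v = 0 := by
    ext i
    simpa [hσ, hne i] using hz i (Finset.mem_univ i)
  have hUU : U * star U = 1 := Unitary.coe_mul_star_self hS.eigenvectorUnitary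
  ext1
  change v = 0
  rw [← one_mulVec v, ← hUU, ← mulVec_mulVec, hw, mulVec_zero]

theorem eigCountR_eq_card {n : ℕ} {Φ : Matrix (Fin n) (Fin n) ℝ}
    (hS : (Φ.map (fun r : ℝ => (r : ℂ))).IsHermitian) (p : ℝ → Prop) :
    eigCountR Φ p = Fintype.card {i // p (hS.eigenvalues i)} := by
  have hΦ : Φ.IsHermitian := by
    ext i j
    have := congrFun (congrFun hS.eq i) j
    simpa using this
  have h : Φ.charpoly.roots = Multiset.map hS.eigenvalues Finset.univ.val := by
    apply Multiset.map_injective Complex.ofReal_injective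
    have h1 := hS.roots_charpoly_eq_eigenvalues
    have h2 : (Φ.map (fun r : ℝ => (r : ℂ))).charpoly = Φ.charpoly.map Complex.ofRealHom :=
      Φ.charpoly_map Complex.ofRealHom
    rw [h2, hΦ.splits_charpoly.roots_map] at h1
    rw [Multiset.map_map]
    exact h1
  rw [eigCountR, h, Multiset.filter_map, Multiset.card_map, Fintype.card_subtype]
  rfl

theorem dotProduct_mulVec_eq_symmPart {n : ℕ} (A : Matrix (Fin n) (Fin n) ℝ) (u : Fin n → ℝ) :
    u ⬝ᵥ (((1 : ℝ) / 2) • (A + Aᵀ)) *ᵥ u = u ⬝ᵥ A *ᵥ u := by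
  have h : u ⬝ᵥ Aᵀ *ᵥ u = u ⬝ᵥ A *ᵥ u := by
    rw [mulVec_transpose, dotProduct_comm, dotProduct_mulVec]
  rw [smul_mulVec, add_mulVec, dotProduct_smul, dotProduct_add, h, smul_eq_mul]
  ring

theorem mulVec_map_re {n : ℕ} (A : Matrix (Fin n) (Fin n) ℝ) (v : Fin n → ℂ) (i : Fin n) :
    ((A.map (fun r : ℝ => (r : ℂ)) *ᵥ v) i).re = (A *ᵥ fun j => (v j).re) i := by
  simp [mulVec, dotProduct]

theorem mulVec_map_im {n : ℕ} (A : Matrix (Fin n) (Fin n) ℝ) (v : Fin n → ℂ) (i : Fin n) :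
    ((A.map (fun r : ℝ => (r : ℂ)) *ᵥ v) i).im = (A *ᵥ fun j => (v j).im) i := by
  simp [mulVec, dotProduct]

theorem re_star_dotProduct_map_mulVec {n : ℕ} (A : Matrix (Fin n) (Fin n) ℝ) (v : Fin n → ℂ) :
    (star v ⬝ᵥ A.map (fun r : ℝ => (r : ℂ)) *ᵥ v).re
      = (fun j => (v j).re) ⬝ᵥ A *ᵥ (fun j => (v j).re)
        + (fun j => (v j).im) ⬝ᵥ A *ᵥ (fun j => (v j).im) := by
  rw [dotProduct, Complex.re_sum]
  simp only [Pi.star_apply, Complex.mul_re, mulVec_map_re, mulVec_map_im]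
  simp [dotProduct, Finset.sum_add_distrib]

/-- The real part of `p⁰` at the point `((x,0) + iε(y,η))`. -/
theorem pZero_re {n : ℕ} (A Φ : Matrix (Fin n) (Fin n) ℝ) (ε : ℝ) (x y η : Fin n → ℝ) :
    (pZero n A Φ (fun j => (x j : ℂ) + (ε : ℂ) * Complex.I * (y j : ℂ))
      (fun j => (ε : ℂ) * Complex.I * (η j : ℂ))).re
      = (Φ *ᵥ x - ε • η) ⬝ᵥ A *ᵥ (Φ *ᵥ x + ε • η) - ε ^ 2 * (Φ *ᵥ y ⬝ᵥ A *ᵥ Φ *ᵥ y) := by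
  have h : ∀ k, (Φ.map (fun r : ℝ => (r : ℂ)) *ᵥ
      fun j => (x j : ℂ) + (ε : ℂ) * Complex.I * (y j : ℂ)) k
      = ((Φ *ᵥ x) k : ℂ) + (ε : ℂ) * Complex.I * ((Φ *ᵥ y) k : ℂ) := by
    intro k
    apply Complex.ext
    · simp [mulVec_map_re]
    · rw [mulVec_map_im]
      simpa [Pi.smul_def] using congrFun (mulVec_smul Φ ε y) k
  simp only [pZero, h]
  generalize Φ *ᵥ x = z
  generalize Φ *ᵥ y = q
  simp only [dotProduct, mulVec, Complex.re_sum, Finset.mul_sum, ← Finset.sum_sub_distrib]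
  refine Finset.sum_congr rfl fun j _ => Finset.sum_congr rfl fun k _ => ?_
  simp
  ring

theorem mulVec_eq_neg_of_posSemidef {n : ℕ} {A : Matrix (Fin n) (Fin n) ℝ}
    (hB : (((1 : ℝ) / 2) • (A + Aᵀ)).PosSemidef) {u : Fin n → ℝ} (hu : u ⬝ᵥ A *ᵥ u = 0) :
    Aᵀ *ᵥ u = -(A *ᵥ u) := by
  have h := (hB.dotProduct_mulVec_zero_iff u).mp (by
    rw [star_trivial, dotProduct_mulVec_eq_symmPart, hu])
  rw [smul_mulVec, add_mulVec, smul_eq_zero] at h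
  exact eq_neg_of_add_eq_zero_right (h.resolve_left (by norm_num))

theorem dotProduct_mulVec_nonneg_of_symmPart {n : ℕ} {A : Matrix (Fin n) (Fin n) ℝ}
    (hB : (((1 : ℝ) / 2) • (A + Aᵀ)).PosSemidef) (u : Fin n → ℝ) : 0 ≤ u ⬝ᵥ A *ᵥ u := by
  rw [← dotProduct_mulVec_eq_symmPart]
  simpa using hB.dotProduct_mulVec_nonneg u

/-- On the kernel of the quadratic form `x ↦ ⟨AΦx, Φx⟩`, the real part of `p⁰` at
`((x,0) + iε(y,η))` is at most `-2ε⟨η, AΦx⟩`. -/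
theorem pZero_re_le {n : ℕ} {A Φ : Matrix (Fin n) (Fin n) ℝ}
    (hB : (((1 : ℝ) / 2) • (A + Aᵀ)).PosSemidef) (ε : ℝ) (x y η : Fin n → ℝ)
    (hx : Φ *ᵥ x ⬝ᵥ A *ᵥ Φ *ᵥ x = 0) :
    (pZero n A Φ (fun j => (x j : ℂ) + (ε : ℂ) * Complex.I * (y j : ℂ))
      (fun j => (ε : ℂ) * Complex.I * (η j : ℂ))).re ≤ -2 * ε * (η ⬝ᵥ A *ᵥ Φ *ᵥ x) := by
  rw [pZero_re]
  have h1 := dotProduct_mulVec_nonneg_of_symmPart hB (Φ *ᵥ y)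
  have h2 := dotProduct_mulVec_nonneg_of_symmPart hB η
  have h3 : Φ *ᵥ x ⬝ᵥ A *ᵥ η = -(η ⬝ᵥ A *ᵥ Φ *ᵥ x) := by
    rw [dotProduct_mulVec, ← mulVec_transpose, mulVec_eq_neg_of_posSemidef hB hx, neg_dotProduct,
      dotProduct_comm]
  simp only [sub_dotProduct, mulVec_add, dotProduct_add, mulVec_smul, dotProduct_smul,
    smul_dotProduct, smul_eq_mul, hx, h3]
  nlinarith [mul_nonneg (sq_nonneg ε) h1, mul_nonneg (sq_nonneg ε) h2]

/-- If the averaging estimate holds for some `ε > 0` then `AΦ` has no purely imaginary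
eigenvalue. -/
theorem re_ne_zero_of_mulVec_eq_smul {n : ℕ} {A Φ : Matrix (Fin n) (Fin n) ℝ}
    (hB : (((1 : ℝ) / 2) • (A + Aᵀ)).PosSemidef) (hΦsymm : Φ.IsSymm)
    {G : Matrix (Fin n ⊕ Fin n) (Fin n ⊕ Fin n) ℝ} (hG : G.IsSymm) {c ε : ℝ} (hc : 0 < c)
    (h : ∀ x ξ : Fin n → ℝ, c * ((∑ j, (x j) ^ 2) + ∑ j, (ξ j) ^ 2)
      ≤ (pZero n A Φ
          (fun j => (x j : ℂ)
            + (ε : ℂ) * Complex.I * (2 * (G.mulVec (Sum.elim x ξ)) (Sum.inr j)))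
          (fun j => (ξ j : ℂ)
            + (ε : ℂ) * Complex.I * (-2 * (G.mulVec (Sum.elim x ξ)) (Sum.inl j)))).re)
    {μ : ℂ} {v : Fin n → ℂ} (hv : v ≠ 0)
    (hμ : (A * Φ).map (fun r : ℝ => (r : ℂ)) *ᵥ v = μ • v) : μ.re ≠ 0 := by
  intro hre
  set a : Fin n → ℝ := fun j => (v j).re with ha
  set b : Fin n → ℝ := fun j => (v j).im with hb
  let g : (Fin n → ℝ) → Fin n → ℝ := fun x j => (G *ᵥ Sum.elim x 0) (Sum.inl j)
  have hab : A *ᵥ Φ *ᵥ a = -μ.im • b := by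
    ext j
    rw [mulVec_mulVec, ha, ← mulVec_map_re, hμ]
    simp [hre, hb]
  have hba : A *ᵥ Φ *ᵥ b = μ.im • a := by
    ext j
    rw [mulVec_mulVec, hb, ← mulVec_map_im, hμ]
    simp [hre, ha]
  have hΦab : Φ *ᵥ a ⬝ᵥ b = Φ *ᵥ b ⬝ᵥ a := by
    rw [dotProduct_comm, dotProduct_mulVec, ← mulVec_transpose, hΦsymm.eq]
  have hsum : Φ *ᵥ a ⬝ᵥ A *ᵥ Φ *ᵥ a + Φ *ᵥ b ⬝ᵥ A *ᵥ Φ *ᵥ b = 0 := by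
    rw [hab, hba, dotProduct_smul, dotProduct_smul, hΦab]
    simp
  have ha0 := dotProduct_mulVec_nonneg_of_symmPart hB (Φ *ᵥ a)
  have hb0 := dotProduct_mulVec_nonneg_of_symmPart hB (Φ *ᵥ b)
  have hest : ∀ x : Fin n → ℝ, Φ *ᵥ x ⬝ᵥ A *ᵥ Φ *ᵥ x = 0 →
      c * ∑ j, (x j) ^ 2 ≤ 4 * ε * (g x ⬝ᵥ A *ᵥ Φ *ᵥ x) := by
    intro x hx
    have h1 := h x 0
    have h2 := pZero_re_le hB ε x (fun j => 2 * (G *ᵥ Sum.elim x 0) (Sum.inr j))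
      ((-2 : ℝ) • g x) hx
    simp only [Pi.smul_apply, smul_eq_mul, Complex.ofReal_mul, Complex.ofReal_neg,
      Complex.ofReal_ofNat, smul_dotProduct, g] at h2
    simp only [Pi.zero_apply, Complex.ofReal_zero, zero_add, ne_eq, OfNat.ofNat_ne_zero,
      not_false_eq_true, zero_pow, Finset.sum_const_zero, add_zero] at h1
    have h3 := h1.trans h2
    simp only [g]
    linarith
  have hea := hest a (by linarith)
  have heb := hest b (by linarith)
  have hgsymm : g a ⬝ᵥ b = g b ⬝ᵥ a := by
    have hgd : ∀ x y : Fin n → ℝ, g x ⬝ᵥ y = G *ᵥ Sum.elim x 0 ⬝ᵥ Sum.elim y 0 := fun x y => by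
      simp [g, dotProduct]
    rw [hgd, hgd, dotProduct_comm, dotProduct_mulVec, ← mulVec_transpose, hG.eq]
  rw [hab, dotProduct_smul, hgsymm, smul_eq_mul] at hea
  rw [hba, dotProduct_smul, smul_eq_mul] at heb
  have hnn : ∀ x : Fin n → ℝ, 0 ≤ ∑ j, (x j) ^ 2 := fun x =>
    Finset.sum_nonneg fun j _ => sq_nonneg _
  have hzero : ∑ j, (a j) ^ 2 + ∑ j, (b j) ^ 2 ≤ 0 :=
    nonpos_of_mul_nonpos_right (a := c) (by linarith) hc
  have hva : ∑ j, (a j) ^ 2 = 0 := by linarith [hnn a, hnn b]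
  have hvb : ∑ j, (b j) ^ 2 = 0 := by linarith [hnn a, hnn b]
  rw [Finset.sum_eq_zero_iff_of_nonneg fun j _ => sq_nonneg _] at hva hvb
  refine hv (funext fun j => Complex.ext ?_ ?_)
  · simpa [ha] using hva j (Finset.mem_univ j)
  · simpa [hb] using hvb j (Finset.mem_univ j)

/-- (Proposition 9.2 b)): if there is a real quadratic form `𝒢` (with
symmetric matrix `G`) such that `Re p⁰((x,ξ) + iεH_𝒢(x,ξ)) ≥ (ε/C)|(x,ξ)|²` for all
`(x,ξ)` and all small `ε > 0`, then `AΦ` has exactly `n₊` eigenvalues with positive and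
`n₋` with negative real part, where `(n₊, n₋)` is the signature of `Φ`. -/
theorem statement11 (n : ℕ) (A Φ : Matrix (Fin n) (Fin n) ℝ)
    (hA : IsUnit A.det)
    (hB : (((1 : ℝ) / 2) • (A + Aᵀ)).PosSemidef)
    (hΦsymm : Φ.IsSymm) (hΦ : IsUnit Φ.det)
    (hG : ∃ G : Matrix (Fin n ⊕ Fin n) (Fin n ⊕ Fin n) ℝ, G.IsSymm ∧
      ∃ C : ℝ, 0 < C ∧ ∃ ε0 : ℝ, 0 < ε0 ∧
        ∀ ε : ℝ, 0 < ε → ε ≤ ε0 → ∀ x ξ : Fin n → ℝ,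
          (ε / C) * ((∑ j, (x j) ^ 2) + ∑ j, (ξ j) ^ 2)
            ≤ (pZero n A Φ
                (fun j => (x j : ℂ)
                  + (ε : ℂ) * Complex.I * (2 * (G.mulVec (Sum.elim x ξ)) (Sum.inr j)))
                (fun j => (ξ j : ℂ)
                  + (ε : ℂ) * Complex.I * (-2 * (G.mulVec (Sum.elim x ξ)) (Sum.inl j)))).re) :
    eigCount ((A * Φ).map (fun r : ℝ => (r : ℂ))) (fun z => 0 < z.re)
        = eigCountR Φ (fun t => 0 < t) ∧
    eigCount ((A * Φ).map (fun r : ℝ => (r : ℂ))) (fun z => z.re < 0)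
        = eigCountR Φ (fun t => t < 0) := by
  obtain ⟨G, hGsymm, C, hC, ε, hε, hest⟩ := hG
  set S : Matrix (Fin n) (Fin n) ℂ := Φ.map (fun r : ℝ => (r : ℂ)) with hS_def
  set M : Matrix (Fin n) (Fin n) ℂ := (A * Φ).map (fun r : ℝ => (r : ℂ)) with hM_def
  have hS : S.IsHermitian := by
    ext i j
    simp [hS_def, hΦsymm.apply]
  have hdet : S.det ≠ 0 := by
    have h : S.det = (Φ.det : ℂ) := (Complex.ofRealHom.map_det Φ).symm
    rw [h]
    exact_mod_cast hΦ.ne_zero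
  have hSM : ∀ v, 0 ≤ (star v ⬝ᵥ (S * M) *ᵥ v).re := by
    have h : S * M = (Φ * (A * Φ)).map (fun r : ℝ => (r : ℂ)) :=
      (Matrix.map_mul (f := Complex.ofRealHom)).symm
    have hq : ∀ x : Fin n → ℝ, 0 ≤ x ⬝ᵥ (Φ * (A * Φ)) *ᵥ x := fun x => by
      have := dotProduct_mulVec_nonneg_of_symmPart hB (Φ *ᵥ x)
      rwa [← mulVec_mulVec, ← mulVec_mulVec, dotProduct_mulVec, ← mulVec_transpose, hΦsymm.eq]
    intro v
    rw [h, re_star_dotProduct_map_mulVec]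
    exact add_nonneg (hq _) (hq _)
  have hroots : ∀ μ ∈ M.charpoly.roots, μ.re ≠ 0 := by
    intro μ hμ
    rw [← M.charpoly_toLin', Polynomial.mem_roots (LinearMap.charpoly_monic _).ne_zero,
      ← End.hasEigenvalue_iff_isRoot_charpoly] at hμ
    obtain ⟨v, hv⟩ := hμ.exists_hasEigenvector
    exact re_ne_zero_of_mulVec_eq_smul hB hΦsymm hGsymm (div_pos hε hC)
      (hest ε hε le_rfl) hv.2 hv.apply_eq_smul
  have hpos : eigCount M (fun z => 0 < z.re) ≤ eigCountR Φ (fun t => 0 < t) := by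
    have h1 := card_filter_roots_charpoly_le_finrank M.toLin' (fun z => 0 < z.re)
      (unstableSubmodule M.toLin') fun μ hμ => maxGenEigenspace_le_unstableSubmodule _ hμ
    have h2 := finrank_le_card_eigenvalues hS hdet one_ne_zero (unstableSubmodule M.toLin')
      fun v hv => by simpa using nonneg_of_mem_unstableSubmodule M S hS hSM hv
    rw [charpoly_toLin'] at h1
    rw [eigCountR_eq_card hS]
    simp only [one_mul] at h2
    exact h1.trans h2
  have hneg : eigCount M (fun z => z.re < 0) ≤ eigCountR Φ (fun t => t < 0) := by
    have h1 := card_filter_roots_charpoly_le_finrank M.toLin' (fun z => z.re < 0)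
      (unstableSubmodule (-M).toLin') fun μ hμ => by
        rw [← maxGenEigenspace_neg_neg, map_neg]
        exact maxGenEigenspace_le_unstableSubmodule _ (by simpa using hμ)
    have h2 := finrank_le_card_eigenvalues hS hdet (neg_ne_zero.mpr one_ne_zero)
      (unstableSubmodule (-M).toLin') fun v hv => by
        simpa [neg_mulVec] using nonneg_of_mem_unstableSubmodule (-M) (-S) hS.neg
          (by simpa using hSM) hv
    rw [charpoly_toLin'] at h1
    rw [eigCountR_eq_card hS]
    simp only [neg_mul, one_mul, Left.neg_pos_iff] at h2
    exact h1.trans h2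
  have htot : eigCount M (fun z => 0 < z.re) + eigCount M (fun z => z.re < 0) = n := by
    have h : M.charpoly.roots.filter (fun z => z.re < 0)
        = M.charpoly.roots.filter (fun z => ¬ 0 < z.re) :=
      Multiset.filter_congr fun z hz =>
        ⟨fun h => not_lt.mpr h.le, fun h => lt_of_le_of_ne (not_lt.mp h) (hroots z hz)⟩
    rw [eigCount, eigCount, h, ← Multiset.card_add, Multiset.filter_add_not,
      ← (IsAlgClosed.splits M.charpoly).natDegree_eq_card_roots, charpoly_natDegree_eq_dim,
      Fintype.card_fin]
  have htotR : eigCountR Φ (fun t => 0 < t) + eigCountR Φ (fun t => t < 0) ≤ n := by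
    rw [eigCountR_eq_card hS, eigCountR_eq_card hS, Fintype.card_subtype, Fintype.card_subtype,
      ← Finset.card_union_of_disjoint]
    · exact (Finset.card_le_univ _).trans_eq (Fintype.card_fin n)
    · exact Finset.disjoint_filter.mpr fun i _ h => h.le.not_gt
  omega
end
end

section
/- For every u ∈ C^∞(ℝ^{2n}): Σ_{j,k=1}^{2n} ( (−h∂_{w_k} + ∂_{w_k}φ) ∘ A_{jk} ∘ (h∂_{w_j} + ∂_{w_j}φ) ) u = (γ/2) Σ_{j=1}^{n} (−h∂_{y_j} + ∂_{y_j}φ)(h∂_{y_j} + ∂_{y_j}φ) u + h H_φ u, where H_φ = Σ_{k=1}^n ( ∂_{y_k}φ · ∂_{x_k} − ∂_{x_k}φ · ∂_{y_k} ). In particular, for φ(x,y) = y²/2 + V(x) this operator equals the Kramers–Fokker–Planck operator y·h∂_x − V'(x)·h∂_y + (γ/2)(−h∂_y + y)·(h∂_y + y). -/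
noncomputable section

/-- The coordinate directions on `ℝ²ⁿ = ℝⁿ_x × ℝⁿ_y`. -/
def dirW (n : ℕ) (i : Fin n ⊕ Fin n) : (Fin n → ℝ) × (Fin n → ℝ) :=
  match i with
  | Sum.inl j => (Pi.single j 1, 0)
  | Sum.inr j => (0, Pi.single j 1)

/-- Partial derivative `∂_{w_i} f (w)` on `ℝ²ⁿ`. -/
def pdW (n : ℕ) (i : Fin n ⊕ Fin n) (f : (Fin n → ℝ) × (Fin n → ℝ) → ℝ)
    (w : (Fin n → ℝ) × (Fin n → ℝ)) : ℝ :=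
  fderiv ℝ f w (dirW n i)

/-- The constant matrix `A = (1/2)[[0, I], [−I, γI]]` (in `n×n` blocks). -/
def Amat (n : ℕ) (γ : ℝ) : Fin n ⊕ Fin n → Fin n ⊕ Fin n → ℝ :=
  fun i k =>
    match i, k with
    | Sum.inl j, Sum.inr l => if j = l then 1 / 2 else 0
    | Sum.inr j, Sum.inl l => if j = l then -(1 / 2) else 0
    | Sum.inr j, Sum.inr l => if j = l then γ / 2 else 0
    | Sum.inl _, Sum.inl _ => 0

/-- The degree-zero Witten–Hodge Laplacian
`−Δ_A^{(0)} u = Σ_{j,k} (−h∂_{w_k} + ∂_{w_k}φ) ∘ A_{jk} ∘ (h∂_{w_j} + ∂_{w_j}φ) u`. -/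
def WittenKFP (n : ℕ) (γ h : ℝ) (φ : (Fin n → ℝ) × (Fin n → ℝ) → ℝ)
    (u : (Fin n → ℝ) × (Fin n → ℝ) → ℝ) (w : (Fin n → ℝ) × (Fin n → ℝ)) : ℝ :=
  ∑ j : Fin n ⊕ Fin n, ∑ k : Fin n ⊕ Fin n,
    (-(h * pdW n k (fun w' =>
          Amat n γ j k * (h * pdW n j u w' + pdW n j φ w' * u w')) w)
      + pdW n k φ w * (Amat n γ j k * (h * pdW n j u w + pdW n j φ w * u w)))

theorem differentiable_pdW {n : ℕ} {f : (Fin n → ℝ) × (Fin n → ℝ) → ℝ}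
    (hf : ContDiff ℝ (⊤ : ℕ∞) f) (i : Fin n ⊕ Fin n) : Differentiable ℝ (pdW n i f) := by
  have h1 : Differentiable ℝ (fderiv ℝ f) :=
    (contDiff_infty_iff_fderiv.1 hf).2.differentiable (by simp)
  exact h1.clm_apply (differentiable_const _)

theorem pdW_pdW_eq_fderiv_fderiv {n : ℕ} {f : (Fin n → ℝ) × (Fin n → ℝ) → ℝ}
    (hf : ContDiff ℝ (⊤ : ℕ∞) f) (i k : Fin n ⊕ Fin n) (w : (Fin n → ℝ) × (Fin n → ℝ)) :
    pdW n k (pdW n i f) w = fderiv ℝ (fderiv ℝ f) w (dirW n k) (dirW n i) := by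
  have h1 : Differentiable ℝ (fderiv ℝ f) :=
    (contDiff_infty_iff_fderiv.1 hf).2.differentiable (by simp)
  have h2 := (h1 w).hasFDerivAt.clm_apply (hasFDerivAt_const (dirW n i) w)
  change fderiv ℝ (fun y => fderiv ℝ f y (dirW n i)) w (dirW n k) = _
  rw [h2.fderiv]
  simp

theorem pdW_comm {n : ℕ} {f : (Fin n → ℝ) × (Fin n → ℝ) → ℝ}
    (hf : ContDiff ℝ (⊤ : ℕ∞) f) (i k : Fin n ⊕ Fin n) (w : (Fin n → ℝ) × (Fin n → ℝ)) :
    pdW n k (pdW n i f) w = pdW n i (pdW n k f) w := by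
  rw [pdW_pdW_eq_fderiv_fderiv hf, pdW_pdW_eq_fderiv_fderiv hf]
  have hsymm : IsSymmSndFDerivAt ℝ f w :=
    hf.contDiffAt.isSymmSndFDerivAt (by simpa using WithTop.coe_le_coe.2 (le_top : (2 : ℕ∞) ≤ ⊤))
  exact hsymm _ _

theorem pdW_const_mul {n : ℕ} {f : (Fin n → ℝ) × (Fin n → ℝ) → ℝ} (hf : Differentiable ℝ f)
    (c : ℝ) (k : Fin n ⊕ Fin n) (w : (Fin n → ℝ) × (Fin n → ℝ)) :
    pdW n k (fun w' => c * f w') w = c * pdW n k f w := by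
  unfold pdW
  rw [fderiv_const_mul (hf w)]
  simp

/-- The Leibniz rule for `∂_{w_k}` applied to `(h∂_{w_j} + ∂_{w_j}φ) u`. -/
theorem pdW_twisted {n : ℕ} {φ u : (Fin n → ℝ) × (Fin n → ℝ) → ℝ}
    (hφ : ContDiff ℝ (⊤ : ℕ∞) φ) (hu : ContDiff ℝ (⊤ : ℕ∞) u) (h : ℝ)
    (j k : Fin n ⊕ Fin n) (w : (Fin n → ℝ) × (Fin n → ℝ)) :
    pdW n k (fun w' => h * pdW n j u w' + pdW n j φ w' * u w') w
      = h * pdW n k (pdW n j u) w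
        + (pdW n j φ w * pdW n k u w + u w * pdW n k (pdW n j φ) w) := by
  have hu1 := (differentiable_pdW hu j w).hasFDerivAt
  have hφ1 := (differentiable_pdW hφ j w).hasFDerivAt
  have hu0 := (hu.differentiable (by simp) w).hasFDerivAt
  have key := (hu1.const_mul h).add (hφ1.mul hu0)
  change fderiv ℝ _ w (dirW n k) = _
  rw [HasFDerivAt.fderiv (f := fun w' => h * pdW n j u w' + pdW n j φ w' * u w') key]
  simp [pdW]

theorem differentiable_twisted {n : ℕ} {φ u : (Fin n → ℝ) × (Fin n → ℝ) → ℝ}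
    (hφ : ContDiff ℝ (⊤ : ℕ∞) φ) (hu : ContDiff ℝ (⊤ : ℕ∞) u) (h : ℝ) (j : Fin n ⊕ Fin n) :
    Differentiable ℝ (fun w' => h * pdW n j u w' + pdW n j φ w' * u w') :=
  ((differentiable_pdW hu j).const_mul h).add
    ((differentiable_pdW hφ j).mul (hu.differentiable (by simp)))

theorem wittenKFP_eq {n : ℕ} {φ u : (Fin n → ℝ) × (Fin n → ℝ) → ℝ}
    (hφ : ContDiff ℝ (⊤ : ℕ∞) φ) (hu : ContDiff ℝ (⊤ : ℕ∞) u) (γ h : ℝ)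
    (w : (Fin n → ℝ) × (Fin n → ℝ)) :
    WittenKFP n γ h φ u w
      = (γ / 2) * ∑ j : Fin n,
          (-(h * pdW n (Sum.inr j) (fun w' =>
                h * pdW n (Sum.inr j) u w' + pdW n (Sum.inr j) φ w' * u w') w)
            + pdW n (Sum.inr j) φ w
              * (h * pdW n (Sum.inr j) u w + pdW n (Sum.inr j) φ w * u w))
        + h * ∑ k : Fin n,
            (pdW n (Sum.inr k) φ w * pdW n (Sum.inl k) u w
              - pdW n (Sum.inl k) φ w * pdW n (Sum.inr k) u w) := by
  have hterm : ∀ j k : Fin n ⊕ Fin n,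
      -(h * pdW n k (fun w' =>
          Amat n γ j k * (h * pdW n j u w' + pdW n j φ w' * u w')) w)
        + pdW n k φ w * (Amat n γ j k * (h * pdW n j u w + pdW n j φ w * u w))
      = Amat n γ j k * (-(h * pdW n k (fun w' =>
          h * pdW n j u w' + pdW n j φ w' * u w') w)
        + pdW n k φ w * (h * pdW n j u w + pdW n j φ w * u w)) := by
    intro j k
    rw [pdW_const_mul (differentiable_twisted hφ hu h j)]
    ring
  simp only [WittenKFP, hterm]
  simp only [Fintype.sum_sum_type, Amat, ite_mul, zero_mul,
    Finset.sum_ite_eq, Finset.mem_univ, if_true, Finset.sum_const_zero, zero_add]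
  simp only [Finset.mul_sum, ← Finset.sum_add_distrib]
  refine Finset.sum_congr rfl fun j _ => ?_
  simp only [pdW_twisted hφ hu]
  rw [pdW_comm hu (Sum.inl j) (Sum.inr j), pdW_comm hφ (Sum.inl j) (Sum.inr j)]
  ring

theorem hasFDerivAt_kineticPotential {n : ℕ} {V : (Fin n → ℝ) → ℝ} (hV : Differentiable ℝ V)
    (w : (Fin n → ℝ) × (Fin n → ℝ)) :
    HasFDerivAt (fun w : (Fin n → ℝ) × (Fin n → ℝ) => (∑ j, (w.2 j) ^ 2) / 2 + V w.1)
      ((∑ j, w.2 j • (ContinuousLinearMap.proj (R := ℝ) j).comp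
          (ContinuousLinearMap.snd ℝ (Fin n → ℝ) (Fin n → ℝ)))
        + (fderiv ℝ V w.1).comp (ContinuousLinearMap.fst ℝ (Fin n → ℝ) (Fin n → ℝ))) w := by
  have hcoord : ∀ j : Fin n, HasFDerivAt (fun w : (Fin n → ℝ) × (Fin n → ℝ) => w.2 j)
      ((ContinuousLinearMap.proj (R := ℝ) j).comp
        (ContinuousLinearMap.snd ℝ (Fin n → ℝ) (Fin n → ℝ))) w := fun j =>
    ((ContinuousLinearMap.proj (R := ℝ) j).comp
        (ContinuousLinearMap.snd ℝ (Fin n → ℝ) (Fin n → ℝ))).hasFDerivAt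
  have hsq := (HasFDerivAt.fun_sum (u := Finset.univ)
    fun j _ => (hcoord j).pow 2).mul_const (2 : ℝ)⁻¹
  have hpot := (hV w.1).hasFDerivAt.comp w
    (ContinuousLinearMap.fst ℝ (Fin n → ℝ) (Fin n → ℝ)).hasFDerivAt
  have key := hsq.add hpot
  refine key.congr_fderiv ?_
  ext v
  · simp
  · simp [Finset.mul_sum, mul_assoc]

theorem pdW_inr_kineticPotential {n : ℕ} {V : (Fin n → ℝ) → ℝ} (hV : Differentiable ℝ V)
    (k : Fin n) (w : (Fin n → ℝ) × (Fin n → ℝ)) :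
    pdW n (Sum.inr k) (fun w => (∑ j, (w.2 j) ^ 2) / 2 + V w.1) w = w.2 k := by
  unfold pdW
  rw [(hasFDerivAt_kineticPotential hV w).fderiv]
  simp [dirW, Pi.single_apply]

theorem pdW_inl_kineticPotential {n : ℕ} {V : (Fin n → ℝ) → ℝ} (hV : Differentiable ℝ V)
    (k : Fin n) (w : (Fin n → ℝ) × (Fin n → ℝ)) :
    pdW n (Sum.inl k) (fun w => (∑ j, (w.2 j) ^ 2) / 2 + V w.1) w
      = fderiv ℝ V w.1 (Pi.single k 1) := by
  unfold pdW
  rw [(hasFDerivAt_kineticPotential hV w).fderiv]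
  simp [dirW]

/-- equations (9.15)–(9.17): for every smooth `u` on `ℝ²ⁿ`,
`−Δ_A^{(0)} u = (γ/2)Σ_j(−h∂_{y_j} + ∂_{y_j}φ)(h∂_{y_j} + ∂_{y_j}φ)u + hH_φ u`, where
`H_φ = Σ_k (∂_{y_k}φ ∂_{x_k} − ∂_{x_k}φ ∂_{y_k})`; in particular for
`φ(x,y) = y²/2 + V(x)` this is the Kramers–Fokker–Planck operator
`y·h∂_x − V'(x)·h∂_y + (γ/2)(−h∂_y + y)·(h∂_y + y)`. -/
theorem statement14 (n : ℕ) (γ h : ℝ) (hh : 0 < h)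
    (φ : (Fin n → ℝ) × (Fin n → ℝ) → ℝ) (hφ : ContDiff ℝ (⊤ : ℕ∞) φ)
    (V : (Fin n → ℝ) → ℝ) (hV : ContDiff ℝ (⊤ : ℕ∞) V)
    (u : (Fin n → ℝ) × (Fin n → ℝ) → ℝ) (hu : ContDiff ℝ (⊤ : ℕ∞) u) :
    (∀ w : (Fin n → ℝ) × (Fin n → ℝ),
      WittenKFP n γ h φ u w
        = (γ / 2) * ∑ j : Fin n,
            (-(h * pdW n (Sum.inr j) (fun w' =>
                  h * pdW n (Sum.inr j) u w' + pdW n (Sum.inr j) φ w' * u w') w)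
              + pdW n (Sum.inr j) φ w
                * (h * pdW n (Sum.inr j) u w + pdW n (Sum.inr j) φ w * u w))
          + h * ∑ k : Fin n,
              (pdW n (Sum.inr k) φ w * pdW n (Sum.inl k) u w
                - pdW n (Sum.inl k) φ w * pdW n (Sum.inr k) u w)) ∧
    (φ = (fun w => (∑ j, (w.2 j) ^ 2) / 2 + V w.1) →
      ∀ w : (Fin n → ℝ) × (Fin n → ℝ),
        WittenKFP n γ h φ u w
          = (∑ j : Fin n, w.2 j * (h * pdW n (Sum.inl j) u w))
            - (∑ j : Fin n,
                fderiv ℝ V w.1 (Pi.single j 1) * (h * pdW n (Sum.inr j) u w))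
            + (γ / 2) * ∑ j : Fin n,
                (-(h * pdW n (Sum.inr j) (fun w' =>
                      h * pdW n (Sum.inr j) u w' + w'.2 j * u w') w)
                  + w.2 j * (h * pdW n (Sum.inr j) u w + w.2 j * u w))) := by
  refine ⟨wittenKFP_eq hφ hu γ h, fun hφV w => ?_⟩
  have hV' : Differentiable ℝ V := hV.differentiable (by simp)
  rw [wittenKFP_eq hφ hu γ h w, hφV]
  simp only [pdW_inr_kineticPotential hV', pdW_inl_kineticPotential hV']
  rw [add_comm, ← Finset.sum_sub_distrib, Finset.mul_sum]
  congr 1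
  exact Finset.sum_congr rfl fun k _ => by ring
end
end
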